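/- Linear independence of the proposed basis: for every N ∈ ℕ and w ∈ ℕ, the family {Li(𝛆;𝔰) : 𝔰 ∈ S_w, 𝛆 ∈ Γ_N^{depth(𝔰)}}, indexed by the pairs (𝔰,𝛆), is linearly independent over K_N inside K_{N,∞}. -/

import Mathlib

noncomputable section

open scoped Classical

namespace ZHPC

variable (Fq : Type) [Field Fq] [Fintype Fq]

/-- `q`, the cardinality of the base finite field `𝔽_q`. -/
def qc : ℕ := Fintype.card Fq

/-- A fixed algebraic closure `𝔽̄_q` of `𝔽_q`. -/
abbrev Fb := AlgebraicClosure Fq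

/-- The field `𝔽̄_q((1/θ))` of formal Laurent series in `1/θ` over `𝔽̄_q`, modeled as the
field of formal Laurent series in one variable, `θ` being the inverse of that variable. -/
abbrev Kinf := LaurentSeries (Fb Fq)

/-- The embedding of the constants `𝔽̄_q → 𝔽̄_q((1/θ))`. -/
def cst : Fb Fq →+* Kinf Fq := HahnSeries.C

/-- The element `θ`. -/
def theta : Kinf Fq := HahnSeries.single (-1 : ℤ) 1

/-- `ℓ_d = ∏_{i=1}^{d} (θ - θ^{q^i})`, with `ℓ_0 = 1`. -/
def ell (d : ℕ) : Kinf Fq := ∏ i ∈ Finset.Icc 1 d, (theta Fq - theta Fq ^ qc Fq ^ i)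

/-- Arrays `(𝛆;𝔰)` of some depth `n`. -/
structure PArr (F : Type) where
  depth : ℕ
  s : Fin depth → ℕ
  eps : Fin depth → F

namespace PArr

variable {F : Type}

/-- A *positive array* for level `N`: all entries `sᵢ` are positive integers and all the
characters `εᵢ` are `N`-th roots of unity. -/
def Positive [Monoid F] (N : ℕ) (A : PArr F) : Prop := (∀ i, 0 < A.s i) ∧ ∀ i, A.eps i ^ N = 1

/-- The weight `w(𝔰) = s₁ + ⋯ + s_n`. -/
def wt (A : PArr F) : ℕ := ∑ i, A.s i

/-- The `i`-th entry of `𝔰` (`0`-indexed), with value `0` beyond the depth. -/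
def sAt (A : PArr F) (i : ℕ) : ℕ := if h : i < A.depth then A.s ⟨i, h⟩ else 0

/-- The partial sums `s₁ + ⋯ + s_i` (entries beyond the depth being `0`). -/
def psum (A : PArr F) (i : ℕ) : ℕ := ∑ j ∈ Finset.range i, A.sAt j

/-- The character `χ(𝛆) = ε₁ ⋯ ε_n`. -/
def chi [CommMonoid F] (A : PArr F) : F := ∏ i, A.eps i

end PArr

/-- The Carlitz multiple polylogarithm at roots of unity
`Li(𝛆;𝔰) = Σ_{d₁ > ⋯ > d_n ≥ 0} ε₁^{d₁}⋯ε_n^{d_n} / (ℓ_{d₁}^{s₁}⋯ℓ_{d_n}^{s_n})`. -/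
def Li (A : PArr (Fb Fq)) : Kinf Fq :=
  ∑' d : {f : Fin A.depth → ℕ // StrictAnti f},
    ∏ i, cst Fq (A.eps i ^ d.1 i) / ell Fq (d.1 i) ^ A.s i

/-- `Si_d(𝛆;𝔰)`: same summand as `Li`, over decreasing tuples with `d₁ = d`. -/
def Sid (d : ℤ) (A : PArr (Fb Fq)) : Kinf Fq :=
  ∑' f : {f : Fin A.depth → ℕ // StrictAnti f ∧ ∀ i : Fin A.depth, i.val = 0 → (f i : ℤ) = d},
    ∏ i, cst Fq (A.eps i ^ f.1 i) / ell Fq (f.1 i) ^ A.s i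

/-- `Si_{<d}(𝛆;𝔰)`: same summand as `Li`, over decreasing tuples with `d > d₁`. -/
def SidLt (d : ℤ) (A : PArr (Fb Fq)) : Kinf Fq :=
  ∑' f : {f : Fin A.depth → ℕ // StrictAnti f ∧ ∀ i : Fin A.depth, (f i : ℤ) < d},
    ∏ i, cst Fq (A.eps i ^ f.1 i) / ell Fq (f.1 i) ^ A.s i

/-- The value at `θ` of the monic polynomial `θ^e + Σ_{j<e} c_j θ^j ∈ A = 𝔽_q[θ]`. -/
def monicVal (e : ℕ) (c : Fin e → Fq) : Kinf Fq :=
  theta Fq ^ e + ∑ j, cst Fq (algebraMap Fq (Fb Fq) (c j)) * theta Fq ^ (j : ℕ)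

/-- The power sum `S_d(𝛆;𝔰)`, a sum over tuples of monic polynomials `a₁, …, a_n ∈ A₊`
with `d = deg a₁ > ⋯ > deg a_n ≥ 0`; a monic polynomial of degree `e` is encoded by its
tuple of lower coefficients `c : Fin e → Fq`. -/
def Sd (d : ℤ) (A : PArr (Fb Fq)) : Kinf Fq :=
  ∑' e : {f : Fin A.depth → ℕ // StrictAnti f ∧ ∀ i : Fin A.depth, i.val = 0 → (f i : ℤ) = d},
    ∑ c : (∀ i, Fin (e.1 i) → Fq),
      ∏ i, cst Fq (A.eps i ^ e.1 i) / monicVal Fq (e.1 i) (c i) ^ A.s i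

/-- The `N`-th cyclotomic multiple zeta value `ζ_A(𝛆;𝔰) = Σ_{d ≥ 0} S_d(𝛆;𝔰)`. -/
def zetaA (A : PArr (Fb Fq)) : Kinf Fq := ∑' d : ℕ, Sd Fq (d : ℤ) A

/-- The cyclotomic field `k_N = 𝔽_q(ζ_N) ⊆ 𝔽̄_q`. -/
def kN (N : ℕ) : Subfield (Fb Fq) :=
  Subfield.closure (Set.range (algebraMap Fq (Fb Fq)) ∪ {x | x ^ N = 1})

/-- The field `K_N = k_N(θ)`, as a subfield of `𝔽̄_q((1/θ))`. -/
def KNf (N : ℕ) : Subfield (Kinf Fq) :=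
  Subfield.closure ((cst Fq '' (kN Fq N : Set (Fb Fq))) ∪ {theta Fq})

/-- The ring `A_N = k_N[θ]`, as a subring of `𝔽̄_q((1/θ))`. -/
def AN (N : ℕ) : Subring (Kinf Fq) :=
  Subring.closure ((cst Fq '' (kN Fq N : Set (Fb Fq))) ∪ {theta Fq})

/-- `CZ_{N,w}`: the `K_N`-span of the `N`-th cyclotomic multiple zeta values of weight `w`. -/
def CZ (N w : ℕ) : Submodule (KNf Fq N) (Kinf Fq) :=
  Submodule.span (KNf Fq N) {x | ∃ A : PArr (Fb Fq), A.Positive N ∧ A.wt = w ∧ x = zetaA Fq A}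

/-- `CL_{N,w}`: the `K_N`-span of the CMPL's at `N`-th roots of unity of weight `w`. -/
def CL (N w : ℕ) : Submodule (KNf Fq N) (Kinf Fq) :=
  Submodule.span (KNf Fq N) {x | ∃ A : PArr (Fb Fq), A.Positive N ∧ A.wt = w ∧ x = Li Fq A}

/-- The index set of pairs `(𝔰,𝛆)` with `𝔰 ∈ S_w` and `𝛆 ∈ Γ_N^{depth 𝔰}`: positive arrays
of weight `w` with `q ∤ sᵢ` for all `i`. -/
def SwIdx (N w : ℕ) : Type :=
  {A : PArr (Fb Fq) // A.Positive N ∧ 0 < A.depth ∧ A.wt = w ∧ ∀ i, ¬ qc Fq ∣ A.s i}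

namespace Core
open Finset

variable {k : Type} [Field k]

def wtL (B : List (ℕ × k)) : ℕ := (B.map Prod.fst).sum
def chL (B : List (ℕ × k)) : k := (B.map fun a => (-1) ^ a.1 * a.2).prod

/-- `r` plus the sum over children. -/
def Ysum {M : Type} [AddCommMonoid M] (I : Finset (List (ℕ × k))) 
    (r : List (ℕ × k) → M) (C : List (ℕ × k)) : M :=
  r C + ∑ D ∈ I.filter (fun D => D ≠ [] ∧ D.tail = C), r D

theorem regroup {R : Type} [CommRing R]
    (I : Finset (List (ℕ × k)))
    (hI : ∀ B ∈ I, B.tail ∈ I) (r g : List (ℕ × k) → R) :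
    ∑ B ∈ I, r B * (g B + if B ≠ [] then g B.tail else 0) = ∑ C ∈ I, Ysum I r C * g C := by
  classical
  unfold Ysum
  simp only [mul_add, add_mul, sum_add_distrib, mul_ite, mul_zero]
  congr 1
  rw [← sum_filter]
  simp only [sum_mul]
  rw [← sum_fiberwise_of_maps_to (s := I.filter (fun B => B ≠ [])) (t := I) (g := List.tail)
    (fun i hi => hI i (mem_filter.1 hi).1)]
  refine sum_congr rfl fun C hC => ?_
  rw [filter_filter]
  refine sum_congr rfl fun D hD => ?_
  rw [(mem_filter.1 hD).2.2]

theorem sum_shift {R : Type} [AddCommMonoid R] (L e : ℕ) (F : ℕ → R) (hF : ∀ n, L ≤ n + e → F n = 0) :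
    ∑ n ∈ range L, (if e ≤ n then F (n - e) else 0) = ∑ n ∈ range L, F n := by
  rw [← sum_filter]
  symm
  rw [← sum_filter_of_ne (s := range L) (p := fun n => n + e < L)]
  · refine sum_bij' (fun n _ => n + e) (fun n _ => n - e) ?_ ?_ ?_ ?_ ?_
    all_goals intro n hn; simp only [mem_filter, mem_range] at hn ⊢
    · omega
    · omega
    · omega
    · omega
    · congr 1; omega
  · intro n _ h
    by_contra h'
    exact h (hF n (by omega))

theorem sum_residue {R : Type} [CommRing R] (q L j : ℕ) (hq : 0 < q) (hj : j < q) (c g : ℕ → R)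
    (hc : ∀ n, L ≤ n → c n = 0) (hg : ∀ n, n % q ≠ j → g n = 0) :
    ∑ n ∈ range L, c n * g n = ∑ n ∈ range L, c (q * n + j) * g (q * n + j) := by
  rw [← sum_filter_of_ne (s := range L) (p := fun n => n % q = j) (f := fun n => c n * g n)]
  · symm
    rw [← sum_filter_of_ne (s := range L) (p := fun n => q * n + j < L)]
    · refine sum_bij' (fun n _ => q * n + j) (fun n _ => n / q) ?_ ?_ ?_ ?_ ?_
      all_goals intro n hn; simp only [mem_filter, mem_range] at hn ⊢
      · refine ⟨hn.2, ?_⟩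
        rw [Nat.mul_add_mod, Nat.mod_eq_of_lt hj]
      · have := Nat.div_add_mod n q
        rw [hn.2] at this
        have h2 := Nat.div_le_self n q
        omega
      · rw [Nat.mul_add_div hq, Nat.div_eq_of_lt hj, add_zero]
      · have := Nat.div_add_mod n q
        rw [hn.2] at this
        exact this
    · intro n _ h
      by_contra h'
      exact h (by rw [hc _ (by omega), zero_mul])
  · intro n _ h
    by_contra h'
    exact h (by rw [hg _ h', mul_zero])

theorem chL_ne {B : List (ℕ × k)} (h : ∀ x ∈ B, x.2 ≠ 0) : chL B ≠ 0 := by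
  unfold chL
  rw [Ne, List.prod_eq_zero_iff]
  simp only [List.mem_map, not_exists, not_and]
  intro x hx
  exact mul_ne_zero (pow_ne_zero _ (neg_ne_zero.2 one_ne_zero)) (h x hx)

theorem wtL_cons (x) (B : List (ℕ × k)) : wtL (x :: B) = x.1 + wtL B := by simp [wtL]
theorem chL_cons (x) (B : List (ℕ × k)) : chL (x :: B) = (-1) ^ x.1 * x.2 * chL B := by simp [chL]

structure Seq (q : ℕ) (a : List (ℕ × k) → ℤ → k) : Prop where
  nil : ∀ i, a [] i = if i = 0 then 1 else 0
  neg : ∀ B i, i < 0 → a B i = 0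
  ndvd : ∀ B i, ¬ (q : ℤ) ∣ i → a B i = 0
  recur : ∀ B, (∀ x ∈ B, 0 < x.1) → ∀ i, a B (q * i) = chL B * a B (i - wtL B) +
    if B ≠ [] then chL B.tail * a B.tail (i - wtL B.tail) else 0

structure Idx (q W : ℕ) (I : Finset (List (ℕ × k))) : Prop where
  tail : ∀ B ∈ I, B.tail ∈ I
  pos : ∀ B ∈ I, ∀ x ∈ B, 0 < x.1
  ndvd : ∀ B ∈ I, ∀ x ∈ B, ¬ q ∣ x.1
  ne : ∀ B ∈ I, ∀ x ∈ B, x.2 ≠ 0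
  wt : ∀ B ∈ I, wtL B ≤ W

structure Rel (a : List (ℕ × k) → ℤ → k) (I : Finset (List (ℕ × k))) (L : ℕ)
    (c : List (ℕ × k) → ℕ → k) : Prop where
  supp : ∀ B n, B ∉ I → c B n = 0
  supp' : ∀ B n, L ≤ n → c B n = 0
  rel : ∀ m : ℤ, ∑ B ∈ I, ∑ n ∈ range L, c B n * a B (m + n) = 0


/-- The Cartier-type operator. -/
def Phi (q : ℕ) (I : Finset (List (ℕ × k))) (w0 j : ℕ) (c : List (ℕ × k) → ℕ → k) :
    List (ℕ × k) → ℕ → k := fun C n =>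
  if w0 - wtL C ≤ n then chL C * Ysum I (fun B => c B (q * (n - (w0 - wtL C)) + j)) C else 0

theorem Ysum_zero_of {I : Finset (List (ℕ × k))} {w0 : ℕ} {c : List (ℕ × k) → ℕ → k}
    (hw : ∀ B n, w0 < wtL B → c B n = 0) {C} (hC : w0 < wtL C) (n : ℕ) :
    Ysum I (fun B => c B n) C = 0 := by
  unfold Ysum
  beta_reduce
  rw [hw C n hC, zero_add]
  refine sum_eq_zero fun D hD => ?_
  simp only [mem_filter] at hD
  obtain ⟨_, h1, h2⟩ := hD
  cases D with
  | nil => exact absurd rfl h1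
  | cons x D => subst h2; refine hw _ _ ?_; rw [wtL_cons]; simp at hC; omega

theorem Phi_rel {q W L w0 j : ℕ} (hq : 2 ≤ q) {a : List (ℕ × k) → ℤ → k} (ha : Seq q a)
    {I : Finset (List (ℕ × k))} (hI : Idx q W I) (hL : 2 * W + 2 ≤ L) (hw0 : w0 ≤ W) (hj : j < q)
    {c : List (ℕ × k) → ℕ → k} (hc : Rel a I L c) (hw : ∀ B n, w0 < wtL B → c B n = 0) :
    Rel a I L (Phi q I w0 j c) ∧ ∀ B n, w0 < wtL B → Phi q I w0 j c B n = 0 := by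
  have hY : ∀ C n, L ≤ n → Ysum I (fun B => c B n) C = 0 := by
    intro C n hn
    unfold Ysum
    beta_reduce
    rw [hc.supp' _ _ hn, zero_add]
    exact sum_eq_zero fun D _ => hc.supp' _ _ hn
  have hbig : ∀ C n, L ≤ n + (w0 - wtL C) → Ysum I (fun B => c B (q * n + j)) C = 0 := by
    intro C n hn
    apply hY
    have : 2 * n ≤ q * n := Nat.mul_le_mul_right n hq
    omega
  refine ⟨⟨?_, ?_, ?_⟩, ?_⟩
  · intro B n hB
    unfold Phi
    split_ifs
    · rw [Ysum, hc.supp _ _ hB, sum_eq_zero, add_zero, mul_zero]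
      intro D hD
      simp only [mem_filter] at hD
      exact absurd (hD.2.2 ▸ hI.tail D hD.1) hB
    · rfl
  · intro B n hn
    unfold Phi
    split_ifs with h
    · rw [hbig, mul_zero]; omega
    · rfl
  · intro m
    have h1 : ∀ C ∈ I, ∑ n ∈ range L, Phi q I w0 j c C n * a C (m + n) =
        ∑ n ∈ range L, Ysum I (fun B => c B (q * n + j)) C *
          (chL C * a C ((m + w0 + n) - wtL C)) := by
      intro C hC
      by_cases hwC : w0 < wtL C
      · rw [sum_eq_zero, sum_eq_zero]
        · intro n _; rw [Ysum_zero_of hw hwC, zero_mul]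
        · intro n _; unfold Phi; rw [Ysum_zero_of hw hwC, mul_zero]; simp
      · refine Eq.trans ?_ (sum_shift L (w0 - wtL C) (fun n : ℕ => Ysum I (fun B => c B (q*n+j)) C * (chL C * a C (m + w0 + n - wtL C))) ?_)
        · refine sum_congr rfl fun n hn => ?_
          unfold Phi
          split_ifs with h
          · have : m + (w0 : ℤ) + ((n - (w0 - wtL C) : ℕ) : ℤ) - wtL C = m + n := by
              push Not at hwC
              rw [Nat.cast_sub h, Nat.cast_sub hwC]; ring
            rw [this]; ring
          · simp
        · intro n hn
          beta_reduce
          rw [hbig C n hn, zero_mul]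
    rw [sum_congr rfl h1, sum_comm]
    have h2 : ∀ n ∈ range L, ∑ C ∈ I, Ysum I (fun B => c B (q * n + j)) C *
          (chL C * a C ((m + w0 + n) - wtL C)) =
          ∑ C ∈ I, c C (q * n + j) * a C ((q * (m + w0) - j) + ((q * n + j : ℕ) : ℤ)) := by
      intro n _
      rw [← regroup I hI.tail (fun B => c B (q * n + j)) (fun C => chL C * a C ((m + w0 + n) - wtL C))]
      refine sum_congr rfl fun C hC => ?_
      have : ((q * (m + w0) - j : ℤ) + ((q * n + j : ℕ) : ℤ)) = q * (m + w0 + n) := by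
        push_cast; ring
      rw [this, ha.recur C (hI.pos C hC)]
    rw [sum_congr rfl h2, sum_comm]
    rw [← hc.rel (q * (m + w0) - j)]
    refine sum_congr rfl fun C _ => ?_
    symm
    apply sum_residue q L j (by omega) hj (c C) (fun n => a C ((q * (m + w0) - j) + n)) (hc.supp' C)
    intro n hn
    apply ha.ndvd
    intro hd
    apply hn
    have h3 : (q : ℤ) ∣ (n : ℤ) - j := by
      have := dvd_sub hd (Dvd.intro (m + w0) rfl : (q : ℤ) ∣ q * (m + w0))
      have e : (n : ℤ) - j = (q * (m + w0) - j + n) - q * (m + w0) := by ring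
      rw [e]; exact this
    have h4 : (j : ℕ) ≡ n [MOD q] := (Nat.modEq_iff_dvd).2 h3
    rw [← h4, Nat.mod_eq_of_lt hj]
  · intro B n hB
    unfold Phi
    rw [Ysum_zero_of hw hB]; simp


theorem wtL_le_tail {D : List (ℕ × k)} (h : D ≠ []) : ∃ x, D = x :: D.tail := by
  cases D with
  | nil => exact absurd rfl h
  | cons x D => exact ⟨x, rfl⟩

theorem drift {q e L : ℕ} (hq : 2 ≤ q) (P : ℕ → Prop) (hP : ∀ n, P n → n < L)
    (hs : ∀ n, P n → e ≤ n ∧ P (q * (n - e))) (n : ℕ) (hn : P n) : q * n = q * e + n := by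
  by_contra hne
  set t : ℤ := (q - 1) * n - q * e with ht
  have ht0 : t ≠ 0 := by
    intro h0
    apply hne
    have : (q : ℤ) * n = q * e + n := by linarith
    exact_mod_cast this
  have key : ∀ i : ℕ, ∃ n', P n' ∧ ((q : ℤ) - 1) * n' - q * e = q ^ i * t := by
    intro i
    induction i with
    | zero => exact ⟨n, hn, by simp [ht]⟩
    | succ i ih =>
      obtain ⟨n', h1, h2⟩ := ih
      obtain ⟨h3, h4⟩ := hs n' h1
      refine ⟨_, h4, ?_⟩
      rw [pow_succ, mul_right_comm, ← h2]
      push_cast [Nat.cast_sub h3]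
      ring
  obtain ⟨n', h1, h2⟩ := key (q * L + q * e)
  have h3 := hP _ h1
  have h4 : q * L + q * e < q ^ (q * L + q * e) := Nat.lt_pow_self (by omega)
  have h5 : ((q * L + q * e : ℕ) : ℤ) < (q : ℤ) ^ (q * L + q * e) := by exact_mod_cast h4
  have h6 : |((q : ℤ) - 1) * n' - q * e| ≤ ((q * L + q * e : ℕ) : ℤ) := by
    have hq' : (2 : ℤ) ≤ q := by exact_mod_cast hq
    have hL' : (n' : ℤ) ≤ L := by exact_mod_cast h3.le
    have a1 : ((q : ℤ) - 1) * n' ≤ q * L := by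
      apply mul_le_mul <;> first | linarith | positivity
    have a2 : 0 ≤ ((q : ℤ) - 1) * n' := mul_nonneg (by linarith) (by positivity)
    have a3 : 0 ≤ (q : ℤ) * e := by positivity
    have a4 : 0 ≤ (q : ℤ) * L := by positivity
    push_cast
    rw [abs_le]; constructor <;> linarith
  rw [h2, abs_mul, abs_of_nonneg (by positivity)] at h6
  have h7 : 1 ≤ |t| := Int.one_le_abs ht0
  have h8 : (q : ℤ) ^ (q * L + q * e) * 1 ≤ (q : ℤ) ^ (q * L + q * e) * |t| :=
    mul_le_mul_of_nonneg_left h7 (by positivity)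
  linarith

theorem rigid {q W L w0 : ℕ} (hq : 2 ≤ q)
    {I : Finset (List (ℕ × k))} (hI : Idx q W I)
    {c : List (ℕ × k) → ℕ → k}
    (hsupp : ∀ B n, L ≤ n → c B n = 0)
    (hw : ∀ B n, w0 < wtL B → c B n = 0)
    (htop : ∀ B n, wtL B = w0 → n ≠ 0 → c B n = 0)
    (χ : k) (hχ : χ ≠ 0)
    (H1 : ∀ j, 0 < j → j < q → ∀ B n, Phi q I w0 j c B n = 0)
    (H0 : ∀ B n, Phi q I w0 0 c B n = χ * c B n) :
    ∀ e, ∀ C ∈ I, wtL C + e = w0 → (∀ n, c C n ≠ 0 → q * n = q * e + n ∧ chL C = χ) ∧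
      (0 < e → ∀ D ∈ I, D ≠ [] → D.tail = C → ∀ n, c D n = 0) := by
  intro e
  induction e using Nat.strong_induction_on with
  | _ e ih =>
  intro C hC he
  have hch : chL C ≠ 0 := chL_ne (hI.ne C hC)
  have hsub : w0 - wtL C = e := by omega
  -- the extracted equations
  have E1 : ∀ n, ¬ q ∣ n → Ysum I (fun B => c B n) C = 0 := by
    intro n hn
    have h := H1 (n % q) (Nat.pos_of_ne_zero fun h => hn (Nat.dvd_of_mod_eq_zero h))
      (Nat.mod_lt _ (by omega)) C (n / q + e)
    unfold Phi at h
    rw [hsub, if_pos (Nat.le_add_left _ _), Nat.add_sub_cancel, Nat.div_add_mod] at h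
    exact (mul_eq_zero.1 h).resolve_left hch
  have E0 : ∀ m, chL C * Ysum I (fun B => c B (q * m)) C = χ * c C (m + e) := by
    intro m
    have h := H0 C (m + e)
    unfold Phi at h
    rw [hsub, if_pos (by omega), Nat.add_sub_cancel] at h
    exact h
  have Elow : ∀ n, n < e → c C n = 0 := by
    intro n hn
    have h := H0 C n
    unfold Phi at h
    rw [hsub, if_neg (by omega)] at h
    exact (mul_eq_zero.1 h.symm).resolve_left hχ
  -- children
  have hchild : ∀ D ∈ I, D ≠ [] → D.tail = C → ∀ n, c D n ≠ 0 →
      ∃ x, D = x :: C ∧ x.1 ≤ e ∧ 0 < x.1 ∧ ¬ q ∣ x.1 ∧ q * n + q * x.1 = q * e + n ∧ chL D = χ := by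
    intro D hD h1 h2 n hn
    obtain ⟨x, hx⟩ := wtL_le_tail h1
    rw [h2] at hx
    have hxD : x ∈ D := by rw [hx]; simp
    have p1 := hI.pos D hD x hxD
    have p2 : x.1 ≤ e := by
      by_contra hlt
      apply hn
      apply hw
      rw [hx, wtL_cons]; omega
    have p3 := (ih (e - x.1) (by omega) D hD (by rw [hx, wtL_cons]; omega)).1 n hn
    refine ⟨x, hx, p2, p1, hI.ndvd D hD x hxD, ?_, p3.2⟩
    have : q * (e - x.1) + q * x.1 = q * e := by rw [← mul_add]; congr 1; omega
    omega
  have hdv : ∀ D ∈ I, D ≠ [] → D.tail = C → ∀ n, c D n ≠ 0 → q ∣ n := by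
    intro D hD h1 h2 n hn
    obtain ⟨x, -, -, -, -, h, -⟩ := hchild D hD h1 h2 n hn
    have : q ∣ q * e + n := h ▸ Dvd.intro (n + x.1) (by ring)
    exact (Nat.dvd_add_right (Dvd.intro _ rfl)).1 this
  have hY : ∀ n, (∀ D ∈ I, D ≠ [] → D.tail = C → c D n = 0) →
      Ysum I (fun B => c B n) C = c C n := by
    intro n h
    unfold Ysum
    rw [sum_eq_zero, add_zero]
    intro D hD
    simp only [mem_filter] at hD
    exact h D hD.1 hD.2.1 hD.2.2
  have hnd : ∀ n, ¬ q ∣ n → c C n = 0 := by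
    intro n hn
    rw [← E1 n hn, hY]
    intro D hD h1 h2
    by_contra h
    exact hn (hdv D hD h1 h2 n h)
  rcases Nat.eq_zero_or_pos e with he0 | hepos
  · subst he0
    refine ⟨?_, fun h => absurd h (lt_irrefl _)⟩
    intro n hn
    have hn0 : n = 0 := by
      by_contra h
      exact hn (htop C n (by omega) h)
    subst hn0
    refine ⟨by simp, ?_⟩
    have h := E0 0
    rw [hY] at h
    · exact mul_right_cancel₀ hn h
    · intro D hD h1 h2
      by_contra h
      obtain ⟨x, -, h3, h4, -⟩ := hchild D hD h1 h2 _ h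
      omega
  · have hstep : ∀ m, q ∣ m + e → chL C * c C (q * m) = χ * c C (m + e) := by
      intro m hm
      rw [← E0 m, hY]
      intro D hD h1 h2
      by_contra h
      obtain ⟨x, -, h3, h4, h5, h6, -⟩ := hchild D hD h1 h2 _ h
      apply h5
      have : q * m + x.1 = e + m := by
        have : q * (q * m + x.1) = q * (e + m) := by linarith
        exact Nat.eq_of_mul_eq_mul_left (by omega) this
      have h7 : q ∣ q * m + x.1 := by rw [this, add_comm]; exact hm
      exact (Nat.dvd_add_right (Dvd.intro _ rfl)).1 h7
    have hmain : ∀ n, c C n ≠ 0 → q * n = q * e + n ∧ chL C = χ := by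
      intro n hn
      have h1 : q * n = q * e + n := by
        refine drift (L := L) hq (fun n => c C n ≠ 0) ?_ ?_ n hn
        · intro n hn
          by_contra h
          exact hn (hsupp _ _ (by omega))
        · intro n hn
          have h1 : e ≤ n := by
            by_contra h
            exact hn (Elow n (by omega))
          have h2 : q ∣ n := by
            by_contra h
            exact hn (hnd n h)
          refine ⟨h1, fun h => hn ?_⟩
          have h3 := hstep (n - e) (by rwa [Nat.sub_add_cancel h1])
          rw [Nat.sub_add_cancel h1, h, mul_zero] at h3
          exact (mul_eq_zero.1 h3.symm).resolve_left hχ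
      refine ⟨h1, ?_⟩
      have h2 : q ∣ n := by
        by_contra h
        exact hn (hnd n h)
      have h4 : e ≤ n := by
        by_contra h
        exact hn (Elow n (by omega))
      have h3 := hstep (n - e) (by rwa [Nat.sub_add_cancel h4])
      have h5 : q * (n - e) = n := by rw [Nat.mul_sub]; omega
      rw [Nat.sub_add_cancel h4, h5] at h3
      exact mul_right_cancel₀ hn h3
    refine ⟨hmain, fun _ D hD h1 h2 n => ?_⟩
    by_contra hn
    obtain ⟨m, rfl⟩ := hdv D hD h1 h2 n hn
    obtain ⟨x, g1, g2, g3, g4, g5, g6⟩ := hchild D hD h1 h2 _ hn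
    have key : ∀ s, q * (q * m) + q * s = q * e + q * m → q * m + s = e + m := by
      intro s hs
      have : q * (q * m + s) = q * (e + m) := by linarith
      exact Nat.eq_of_mul_eq_mul_left (by omega) this
    have g7 := key _ g5
    have z1 : c C (m + e) = 0 := by
      apply hnd
      intro h
      apply g4
      have h7 : q ∣ q * m + x.1 := by rw [g7, add_comm]; exact h
      exact (Nat.dvd_add_right (Dvd.intro _ rfl)).1 h7
    have z2 : c C (q * m) = 0 := by
      by_contra h
      have h8 := (hmain _ h).1
      have := key 0 (by omega)
      omega
    have h9 := E0 m
    rw [z1, mul_zero] at h9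
    have h10 := (mul_eq_zero.1 h9).resolve_left hch
    unfold Ysum at h10
    beta_reduce at h10
    rw [z2, zero_add, sum_eq_single D] at h10
    · exact hn h10
    · intro D' hD' hne
      simp only [mem_filter] at hD'
      by_contra hn'
      obtain ⟨x', f1, f2, f3, f4, f5, f6⟩ := hchild D' hD'.1 hD'.2.1 hD'.2.2 _ hn'
      have f7 := key _ f5
      apply hne
      rw [g1, f1]
      congr 1
      have hs : x'.1 = x.1 := by omega
      refine Prod.ext hs ?_
      rw [← g6, f1, g1, chL_cons, chL_cons, hs] at f6
      have f8 := mul_right_cancel₀ hch f6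
      exact mul_left_cancel₀ (pow_ne_zero _ (neg_ne_zero.2 one_ne_zero)) f8
    · intro h
      exact absurd (mem_filter.2 ⟨hD, h1, h2⟩) h

theorem Rel.sub_smul {a : List (ℕ × k) → ℤ → k} {I : Finset (List (ℕ × k))} {L : ℕ}
    {c d : List (ℕ × k) → ℕ → k} (hc : Rel a I L c) (hd : Rel a I L d) (χ : k) :
    Rel a I L (fun B n => d B n - χ * c B n) := by
  refine ⟨fun B n h => ?_, fun B n h => ?_, fun m => ?_⟩
  · rw [hc.supp B n h, hd.supp B n h]; simp
  · rw [hc.supp' B n h, hd.supp' B n h]; simp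
  · have h1 := hc.rel m
    have h2 := hd.rel m
    simp only [sub_mul, sum_sub_distrib, mul_assoc, ← mul_sum]
    rw [h1, h2]; simp

theorem Phi_top {q W w0 j : ℕ} 
    {I : Finset (List (ℕ × k))} (hI : Idx q W I) 
    {c : List (ℕ × k) → ℕ → k} (hw : ∀ B n, w0 < wtL B → c B n = 0) (B : List (ℕ × k)) (n : ℕ)
    (hB : wtL B = w0) : Phi q I w0 j c B n = chL B * c B (q * n + j) := by
  unfold Phi Ysum
  rw [hB, Nat.sub_self, if_pos (Nat.zero_le _), sum_eq_zero]
  · simp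
  · intro D hD
    simp only [mem_filter] at hD
    apply hw
    obtain ⟨x, hx⟩ := wtL_le_tail hD.2.1
    have := hI.pos D hD.1 x (by rw [hx]; simp)
    rw [hx, wtL_cons, hD.2.2]
    omega

theorem top_const {q W L w0 : ℕ} (hq : 2 ≤ q) {a : List (ℕ × k) → ℤ → k} (ha : Seq q a)
    {I : Finset (List (ℕ × k))} (hI : Idx q W I) (hL : 2 * W + 2 ≤ L) (hw0 : w0 ≤ W) :
    ∀ d : ℕ, ∀ c : List (ℕ × k) → ℕ → k, Rel a I L c → (∀ B n, w0 < wtL B → c B n = 0) →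
    (∀ B n, wtL B = w0 → d < n → c B n = 0) → (∃ B, wtL B = w0 ∧ c B d ≠ 0) →
    ∃ c' : List (ℕ × k) → ℕ → k, Rel a I L c' ∧ (∀ B n, w0 < wtL B → c' B n = 0) ∧
    (∀ B n, wtL B = w0 → n ≠ 0 → c' B n = 0) ∧ (∃ B, wtL B = w0 ∧ c' B 0 ≠ 0) := by
  intro d
  induction d using Nat.strong_induction_on with
  | _ d ih =>
  intro c hc hw hd hB
  rcases Nat.eq_zero_or_pos d with h0 | hpos
  · subst h0
    exact ⟨c, hc, hw, fun B n h1 h2 => hd B n h1 (Nat.pos_of_ne_zero h2), hB⟩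
  · obtain ⟨B, hB1, hB2⟩ := hB
    have hjq : d % q < q := Nat.mod_lt _ (by omega)
    have hP := Phi_rel (j := d % q) hq ha hI hL hw0 hjq hc hw
    refine ih (d / q) (Nat.div_lt_self hpos (by omega)) _ hP.1 hP.2 ?_ ⟨B, hB1, ?_⟩
    · intro B n h1 h2
      rw [Phi_top hI hw B n h1, hd B _ h1, mul_zero]
      have := Nat.div_add_mod d q
      have : q * (d / q) < q * n := Nat.mul_lt_mul_of_pos_left h2 (by omega)
      omega
    · rw [Phi_top hI hw B _ hB1, Nat.div_add_mod]
      refine mul_ne_zero (chL_ne (hI.ne B ?_)) hB2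
      by_contra h
      exact hB2 (hc.supp _ _ h)

theorem indep_aux {q W L : ℕ} (hq : 2 ≤ q) {a : List (ℕ × k) → ℤ → k} (ha : Seq q a)
    {I : Finset (List (ℕ × k))} (hI : Idx q W I) (hL : 2 * W + 2 ≤ L) :
    ∀ w0, w0 ≤ W → ∀ c : List (ℕ × k) → ℕ → k, Rel a I L c →
    (∀ B n, w0 < wtL B → c B n = 0) → ∀ B n, c B n = 0 := by
  intro w0
  induction w0 with
  | zero =>
    intro _ c hc hw B n
    by_contra hn
    have hnil : ∀ B ∈ I, B ≠ [] → ∀ n, c B n = 0 := by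
      intro B hB h n
      apply hw
      obtain ⟨x, hx⟩ := wtL_le_tail h
      have := hI.pos B hB x (by rw [hx]; simp)
      rw [hx, wtL_cons]; omega
    have hBI : B ∈ I := by
      by_contra h; exact hn (hc.supp _ _ h)
    have hB : B = [] := by
      by_contra h; exact hn (hnil B hBI h n)
    subst hB
    have h := hc.rel (-n)
    rw [sum_eq_single [], sum_eq_single n] at h
    · rw [ha.nil] at h; simp at h; exact hn h
    · intro n' _ hne
      rw [ha.nil, if_neg, mul_zero]; omega
    · intro h'
      simp only [mem_range, not_lt] at h'
      rw [hc.supp' _ _ h', zero_mul]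
    · intro B' hB' hne
      exact sum_eq_zero fun n' _ => by rw [hnil B' hB' hne, zero_mul]
    · intro h; exact absurd hBI h
  | succ v ih =>
    intro hv c hc hw
    -- no relation with constant tops
    have hno : ∀ t : ℕ, ∀ c : List (ℕ × k) → ℕ → k, Rel a I L c →
        (∀ B n, v + 1 < wtL B → c B n = 0) → (∀ B n, wtL B = v + 1 → n ≠ 0 → c B n = 0) →
        (I.filter (fun B => wtL B = v + 1 ∧ c B 0 ≠ 0)).card = t →
        ∀ B, wtL B = v + 1 → c B 0 = 0 := by
      intro t
      induction t using Nat.strong_induction_on with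
      | _ t iht =>
      intro c hc hw htop hT B0 hB0
      by_contra hne
      have hB0I : B0 ∈ I := by
        by_contra h; exact hne (hc.supp _ _ h)
      have hχ := chL_ne (hI.ne B0 hB0I)
      have H1 : ∀ j, 0 < j → j < q → ∀ B n, Phi q I (v + 1) j c B n = 0 := by
        intro j hj hjq
        have hP := Phi_rel hq ha hI hL hv hjq hc hw
        refine ih (by omega) _ hP.1 ?_
        intro B n hB
        rcases Nat.lt_or_ge (v + 1) (wtL B) with h | h
        · exact hP.2 B n h
        · rw [Phi_top hI hw B n (by omega), htop B _ (by omega) (by omega), mul_zero]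
      have hP := Phi_rel (j := 0) hq ha hI hL hv (by omega) hc hw
      have H0 : ∀ B n, Phi q I (v + 1) 0 c B n = chL B0 * c B n := by
        have hR := hc.sub_smul hP.1 (chL B0)
        have hw' : ∀ B n, v + 1 < wtL B → Phi q I (v + 1) 0 c B n - chL B0 * c B n = 0 := by
          intro B n h; rw [hP.2 B n h, hw B n h]; simp
        have ht' : ∀ B n, wtL B = v + 1 → n ≠ 0 → Phi q I (v + 1) 0 c B n - chL B0 * c B n = 0 := by
          intro B n h h'
          rw [Phi_top hI hw B n h, htop B n h h', htop B _ h]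
          · simp
          · have : q * n ≠ 0 := mul_ne_zero (by omega) h'
            omega
        have h0 := iht _ ?_ _ hR hw' ht' rfl
        · have := ih (by omega) _ hR ?_
          · intro B n; exact sub_eq_zero.1 (this B n)
          · intro B n hB
            rcases Nat.lt_or_ge (v + 1) (wtL B) with h | h
            · exact hw' B n h
            · by_cases hn : n = 0
              · subst hn; exact h0 B (by omega)
              · exact ht' B n (by omega) hn
        · rw [← hT]
          apply Finset.card_lt_card
          rw [Finset.ssubset_iff_of_subset]
          · refine ⟨B0, mem_filter.2 ⟨hB0I, hB0, hne⟩, ?_⟩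
            intro h
            apply (mem_filter.1 h).2.2
            rw [Phi_top hI hw B0 0 hB0]; simp
          · intro B hB
            simp only [mem_filter] at hB ⊢
            refine ⟨hB.1, hB.2.1, fun h => hB.2.2 ?_⟩
            rw [Phi_top hI hw B 0 hB.2.1]; simp [h]
      have hr := rigid (L := L) hq hI hc.supp' hw htop (chL B0) hχ H1 H0
      have hnn : B0 ≠ [] := by
        rintro rfl; simp [wtL] at hB0
      obtain ⟨x, hx⟩ := wtL_le_tail hnn
      have hx1 := hI.pos B0 hB0I x (by rw [hx]; simp)
      have hwt : wtL B0.tail + x.1 = v + 1 := by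
        rw [← hB0]; conv_rhs => rw [hx, wtL_cons]
        omega
      exact hne ((hr x.1 B0.tail (hI.tail _ hB0I) hwt).2 hx1 B0 hB0I hnn rfl 0)
    apply ih (by omega) c hc
    intro B n hB
    rcases Nat.lt_or_ge (v + 1) (wtL B) with h | h
    · exact hw B n h
    by_contra hn
    -- maximal top degree
    have hex : ∃ n, (∃ B, wtL B = v + 1 ∧ c B n ≠ 0) := ⟨n, B, by omega, hn⟩
    have hbd : ∀ n, (∃ B, wtL B = v + 1 ∧ c B n ≠ 0) → n ≤ L := by
      rintro n ⟨B, _, h⟩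
      by_contra h'
      exact h (hc.supp' _ _ (by omega))
    have hd1 := Nat.findGreatest_spec (P := fun n => ∃ B, wtL B = v + 1 ∧ c B n ≠ 0)
      (hbd _ hex.choose_spec) hex.choose_spec
    obtain ⟨c', r1, r2, r3, B', r4, r5⟩ := top_const hq ha hI hL hv _ c hc hw (by
      intro B n h1 h2
      by_contra h3
      have := Nat.findGreatest_is_greatest h2 (hbd n ⟨B, h1, h3⟩)
      exact this ⟨B, h1, h3⟩) hd1
    exact r5 (hno _ c' r1 r2 r3 rfl B' r4)

theorem indep {q W L : ℕ} (hq : 2 ≤ q) {a : List (ℕ × k) → ℤ → k} (ha : Seq q a)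
    {I : Finset (List (ℕ × k))} (hI : Idx q W I) (hL : 2 * W + 2 ≤ L)
    (c : List (ℕ × k) → ℕ → k) (hc : Rel a I L c) : ∀ B n, c B n = 0 := by
  refine indep_aux hq ha hI hL W le_rfl c hc ?_
  intro B n hB
  apply hc.supp
  intro h
  exact absurd (hI.wt B h) (by omega)


open Polynomial

open Polynomial in
def Nb (q : ℕ) : ℕ → List (ℕ × k) → k[X]
  | 0, B => if B = [] then 1 else 0
  | M + 1, B => expand k q (C (chL B) * X ^ wtL B * Nb q M B +
      if B ≠ [] then C (chL B.tail) * X ^ wtL B.tail * Nb q M B.tail else 0)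

open Polynomial

theorem Nb_nil {q : ℕ} (M : ℕ) : Nb (k := k) q M [] = 1 := by
  induction M with
  | zero => simp [Nb]
  | succ M ih => simp [Nb, ih, chL, wtL]

theorem wtL_pos {B : List (ℕ × k)} (h : ∀ x ∈ B, 0 < x.1) (hB : B ≠ []) : 0 < wtL B := by
  obtain ⟨x, hx⟩ := wtL_le_tail hB
  have := h x (by rw [hx]; simp)
  rw [hx, wtL_cons]; omega

theorem Nb_stab_step {q : ℕ} (hq : 2 ≤ q) (M : ℕ) : ∀ B : List (ℕ × k), (∀ x ∈ B, 0 < x.1) → ∀ i, i < M →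
    (Nb q (M + 1) B).coeff i = (Nb q M B).coeff i := by
  induction M with
  | zero => intro B _ i hi; omega
  | succ M ih =>
    intro B hB i hi
    have key : ∀ D : List (ℕ × k), (∀ x ∈ D, 0 < x.1) → ∀ j ≤ M,
        (C (chL D) * X ^ wtL D * Nb q (M + 1) D).coeff j = (C (chL D) * X ^ wtL D * Nb q M D).coeff j := by
      intro D hD j hj
      by_cases h : D = []
      · subst h; rw [Nb_nil, Nb_nil]
      · have := wtL_pos hD h
        rw [mul_assoc, mul_assoc, coeff_C_mul, coeff_C_mul, coeff_X_pow_mul', coeff_X_pow_mul']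
        split_ifs with h1
        · rw [ih D hD _ (by omega)]
        · rfl
    have hr : ∀ M, (Nb q (M + 1) B).coeff i = if q ∣ i then (C (chL B) * X ^ wtL B * Nb q M B +
      if B ≠ [] then C (chL B.tail) * X ^ wtL B.tail * Nb q M B.tail else 0).coeff (i / q) else 0 := by
      intro M; rw [Nb, coeff_expand (by omega)]
    rw [hr (M + 1), hr M]
    split_ifs with h1 h2
    · have hj : i / q ≤ M := by have := Nat.div_le_self i q; omega
      rw [coeff_add, coeff_add, key B hB _ hj]
      rw [key B.tail (fun x hx => hB x (List.mem_of_mem_tail hx)) _ hj]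
    · have hj : i / q ≤ M := by have := Nat.div_le_self i q; omega
      rw [coeff_add, coeff_add, key B hB _ hj]
    · rfl

theorem Nb_stab {q : ℕ} (hq : 2 ≤ q) (B : List (ℕ × k)) (hB : ∀ x ∈ B, 0 < x.1) (i M M' : ℕ)
    (h : i < M) (h' : M ≤ M') : (Nb q M' B).coeff i = (Nb q M B).coeff i := by
  induction M', h' using Nat.le_induction with
  | base => rfl
  | succ M' h' ih => rw [Nb_stab_step hq M' B hB i (by omega), ih]

def sq (q : ℕ) (B : List (ℕ × k)) (i : ℤ) : k :=
  if i < 0 then 0 else (Nb q (i.toNat + 1) B).coeff i.toNat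

theorem sq_seq {q : ℕ} (hq : 2 ≤ q) : Seq (k := k) q (sq q) := by
  refine ⟨?_, ?_, ?_, ?_⟩
  · intro i
    unfold sq
    rw [Nb_nil]
    split_ifs with h1 h2 h2
    · omega
    · rfl
    · subst h2; simp
    · rw [coeff_one, if_neg]; omega
  · intro B i hi
    unfold sq; rw [if_pos hi]
  · intro B i hi
    unfold sq
    split_ifs with h
    · rfl
    · rw [Nb, coeff_expand (by omega), if_neg]
      intro h'
      apply hi
      have : ((q : ℕ) : ℤ) ∣ (i.toNat : ℤ) := by exact_mod_cast h'
      rwa [Int.toNat_of_nonneg (by omega)] at this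
  · intro B hB i
    rcases lt_or_ge i 0 with hi | hi
    · have h1 : (q : ℤ) * i < 0 := mul_neg_of_pos_of_neg (by positivity) hi
      have hz : ∀ (D : List (ℕ × k)) (i : ℤ), i < 0 → sq q D i = 0 := by
        intro D i hi
        unfold sq; rw [if_pos hi]
      rw [hz _ _ h1, hz B _ (by omega), hz B.tail _ (by omega)]
      simp
    · lift i to ℕ using hi
      have key : ∀ D : List (ℕ × k), (∀ x ∈ D, 0 < x.1) →
          (C (chL D) * X ^ wtL D * Nb q (q * i) D).coeff i = chL D * sq q D (i - wtL D) := by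
        intro D hD
        rw [mul_assoc, coeff_C_mul, coeff_X_pow_mul']
        congr 1
        unfold sq
        by_cases h1 : wtL D ≤ i
        · rw [if_pos h1, if_neg (by omega)]
          have : ((i : ℤ) - wtL D).toNat = i - wtL D := by omega
          rw [this]
          by_cases h : D = []
          · subst h; rw [Nb_nil, Nb_nil]
          · have := wtL_pos hD h
            have h5 : 2 * i ≤ q * i := Nat.mul_le_mul_right i hq
            exact Nb_stab hq D hD _ _ _ (by omega) (by omega)
        · rw [if_neg h1, if_pos (by omega)]
      have h2 : ((q : ℤ) * (i : ℤ)).toNat = q * i := by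
        rw [← Nat.cast_mul]; rfl
      conv_lhs => unfold sq
      rw [if_neg (not_lt.2 (by positivity)), h2, Nb, coeff_expand (by omega), if_pos (Dvd.intro _ rfl),
        Nat.mul_div_cancel_left _ (by omega), coeff_add, key B hB]
      congr 1
      split_ifs with h
      · exact key _ (fun x hx => hB x (List.mem_of_mem_tail hx))
      · simp

/-- choice of truncation level -/
theorem exists_level [Finite k] {q W : ℕ} (hq : 2 ≤ q) {I : Finset (List (ℕ × k))} (hI : Idx q W I)
    (J : ℕ) : ∃ n0 : ℕ, ∀ R : List (ℕ × k) → k[X], (∀ B ∈ I, (R B).natDegree ≤ J) →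
      (∃ B ∈ I, R B ≠ 0) → ∀ M, n0 < M → ∃ n ≤ n0, (∑ B ∈ I, R B * Nb q M B).coeff n ≠ 0 := by
  let Tup := I → Fin (J + 1) → k
  let cf : Tup → List (ℕ × k) → ℕ → k := fun t B n =>
    if h : B ∈ I then if h' : n ≤ J then t ⟨B, h⟩ ⟨J - n, by omega⟩ else 0 else 0
  have hex : ∀ t : Tup, t ≠ 0 → ∃ n : ℕ, ∑ B ∈ I, ∑ i ∈ range (J + 1), cf t B (J - i) * sq q B (n - i) ≠ 0 := by
    intro t ht
    by_contra! hcon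
    apply ht
    have hR : Rel (sq q) I (max (J + 1) (2 * W + 2)) (cf t) := by
      refine ⟨?_, ?_, ?_⟩
      · intro B n hB; simp only [cf, dif_neg hB]
      · intro B n hn
        have : ¬ n ≤ J := by omega
        simp only [cf, dif_neg this]; simp
      · intro m
        have h1 : ∀ B ∈ I, ∑ n ∈ range (max (J + 1) (2 * W + 2)), cf t B n * sq q B (m + n) =
            ∑ i ∈ range (J + 1), cf t B (J - i) * sq q B (m + J - i) := by
          intro B _
          rw [← sum_subset (s₁ := range (J + 1))]
          · rw [← sum_range_reflect]
            refine sum_congr rfl fun i hi => ?_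
            simp only [mem_range] at hi
            have : J + 1 - 1 - i = J - i := by omega
            rw [this]
            congr 2
            omega
          · intro x; simp only [mem_range]; omega
          · intro n _ hn
            simp only [mem_range] at hn
            have : ¬ n ≤ J := by omega
            simp only [cf, dif_neg this]; simp
        rw [sum_congr rfl h1]
        rcases lt_or_ge (m + J) 0 with h | h
        · refine sum_eq_zero fun B _ => sum_eq_zero fun i _ => ?_
          rw [(sq_seq hq).neg _ _ (by omega), mul_zero]
        · have h2 := hcon (m + J).toNat
          rw [Int.toNat_of_nonneg h] at h2
          exact h2
    have h0 := indep hq (sq_seq hq) hI (le_max_right _ _) _ hR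
    funext B i
    have := h0 B.1 (J - i.1)
    simp only [cf, dif_pos B.2, dif_pos (Nat.sub_le J i.1)] at this
    have e : (⟨J - (J - i.1), by omega⟩ : Fin (J + 1)) = i := by
      ext; simp only; omega
    rw [e] at this
    exact this
  choose! nf hnf using hex
  have : Finite Tup := inferInstance
  have : Fintype Tup := Fintype.ofFinite _
  refine ⟨Finset.univ.sup nf, ?_⟩
  rintro R hR ⟨B0, hB0, hne⟩ M hM
  let t : Tup := fun B i => (R B.1).coeff i
  have ht : t ≠ 0 := by
    intro h
    apply hne
    ext i
    rw [coeff_zero]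
    by_cases hi : i ≤ J
    · exact congrFun (congrFun h ⟨B0, hB0⟩) ⟨i, by omega⟩
    · exact coeff_eq_zero_of_natDegree_lt (by have := hR B0 hB0; omega)
  have hle : nf t ≤ Finset.univ.sup nf := Finset.le_sup (Finset.mem_univ t)
  refine ⟨nf t, hle, ?_⟩
  convert hnf t ht using 1
  rw [finsetSum_coeff]
  refine sum_congr rfl fun B hB => ?_
  have hcf : ∀ i ≤ J, cf t B (J - i) = (R B).coeff i := by
    intro i hi
    simp only [cf, dif_pos hB, dif_pos (Nat.sub_le J i), t]
    congr 1; omega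
  rw [coeff_mul, Nat.sum_antidiagonal_eq_sum_range_succ_mk]
  have hz : ∀ i ∈ range (nf t + 1), (R B).coeff i * (Nb q M B).coeff (nf t - i) =
      (R B).coeff i * sq q B (nf t - i) := by
    intro i hi
    simp only [mem_range] at hi
    congr 1
    unfold sq
    have e : ((nf t : ℤ) - i).toNat = nf t - i := by omega
    rw [if_neg (by omega), e]
    exact Nb_stab hq B (hI.pos B hB) _ _ _ (by omega) (by omega)
  rw [sum_congr rfl hz]
  have h3 : ∀ i, (nf t < i ∨ J < i) → (R B).coeff i * sq q B (nf t - i) = 0 := by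
    rintro i (h | h)
    · rw [(sq_seq hq).neg _ _ (by omega), mul_zero]
    · rw [coeff_eq_zero_of_natDegree_lt, zero_mul]
      have := hR B hB; omega
  trans ∑ i ∈ range (max (nf t + 1) (J + 1)), (R B).coeff i * sq q B (nf t - i)
  · apply sum_subset
    · intro x; simp only [mem_range]; omega
    · intro x _ hx; apply h3; simp only [mem_range] at hx; omega
  · symm
    rw [sum_congr rfl (g := fun i : ℕ => (R B).coeff i * sq q B (nf t - i))]
    · apply sum_subset
      · intro x; simp only [mem_range]; omega
      · intro x _ hx; apply h3; simp only [mem_range] at hx; omega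
    · intro i hi
      simp only [mem_range] at hi
      rw [hcf i (by omega)]

section Og
variable {E : Type} [Field E]

def Og (n : ℤ) (v : LaurentSeries E) : Prop := ∀ i < n, v.coeff i = 0

theorem Og.add {n : ℤ} {u v : LaurentSeries E} (hu : Og n u) (hv : Og n v) : Og n (u + v) := by
  intro i hi
  rw [HahnSeries.coeff_add, hu i hi, hv i hi, add_zero]

theorem Og.neg {n : ℤ} {u : LaurentSeries E} (hu : Og n u) : Og n (-u) := by
  intro i hi
  rw [HahnSeries.coeff_neg, hu i hi, neg_zero]

theorem Og.sub {n : ℤ} {u v : LaurentSeries E} (hu : Og n u) (hv : Og n v) : Og n (u - v) := by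
  rw [sub_eq_add_neg]; exact hu.add hv.neg

theorem Og.zero (n : ℤ) : Og n (0 : LaurentSeries E) := fun i _ => by simp

theorem Og.mono {n m : ℤ} {u : LaurentSeries E} (hu : Og n u) (h : m ≤ n) : Og m u :=
  fun i hi => hu i (by omega)

theorem Og.mul {n m : ℤ} {u v : LaurentSeries E} (hu : Og n u) (hv : Og m v) :
    Og (n + m) (u * v) := by
  intro i hi
  rw [HahnSeries.coeff_mul]
  refine sum_eq_zero fun p hp => ?_
  rw [mem_addAntidiagonal] at hp
  by_cases h : p.1 < n
  · rw [hu _ h, zero_mul]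
  · rw [hv _ (by omega), mul_zero]

theorem Og.sum {ι : Type*} {n : ℤ} (s : Finset ι) (f : ι → LaurentSeries E) (h : ∀ i ∈ s, Og n (f i)) :
    Og n (∑ i ∈ s, f i) := by
  classical
  induction s using Finset.induction_on with
  | empty => simpa using Og.zero n
  | insert a s ha ih =>
    rw [sum_insert ha]
    exact (h a (mem_insert_self _ _)).add (ih fun i hi => h i (mem_insert_of_mem hi))

theorem Og.single (n : ℤ) (x : E) : Og n (HahnSeries.single n x : LaurentSeries E) := by
  intro i hi
  rw [HahnSeries.coeff_single_of_ne (by omega)]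

theorem Og.one : Og 0 (1 : LaurentSeries E) := Og.single 0 1

theorem Og.pow {u : LaurentSeries E} (hu : Og 0 u) (j : ℕ) : Og 0 (u ^ j) := by
  induction j with
  | zero => simpa using Og.one
  | succ j ih => rw [pow_succ]; simpa using ih.mul hu

theorem Og.pow' {n : ℤ} {u : LaurentSeries E} (hu : Og n u) (j : ℕ) : Og (j * n) (u ^ j) := by
  induction j with
  | zero => simpa using Og.one
  | succ j ih => rw [pow_succ]; have := ih.mul hu; push_cast; rwa [add_mul, one_mul]

variable (E) in
def th : LaurentSeries E := HahnSeries.single (-1 : ℤ) 1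

variable (ι : k →+* E)

def phi : k[X] →+* LaurentSeries E := eval₂RingHom (HahnSeries.C.comp ι) (th E)

theorem th_pow (n : ℕ) : (th E) ^ n = HahnSeries.single (-n : ℤ) 1 := by
  rw [th, HahnSeries.single_pow]; simp

theorem phi_eq (p : k[X]) (d : ℕ) (hd : p.natDegree ≤ d) :
    phi ι p = ∑ i ∈ range (d + 1), HahnSeries.single (-i : ℤ) (ι (p.coeff i)) := by
  rw [phi, coe_eval₂RingHom, eval₂_eq_sum_range' _ (show p.natDegree < d + 1 by omega)]
  refine sum_congr rfl fun i _ => ?_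
  rw [th_pow]
  simp [HahnSeries.C_apply]

theorem phi_coeff (p : k[X]) (n : ℕ) : (phi ι p).coeff (-n : ℤ) = ι (p.coeff n) := by
  rw [phi_eq ι p (max p.natDegree n) (le_max_left _ _), HahnSeries.coeff_sum, sum_eq_single n]
  · simp
  · intro b _ hb
    rw [HahnSeries.coeff_single_of_ne (by omega)]
  · intro h; simp at h

theorem phi_Og (p : k[X]) (d : ℕ) (hd : p.natDegree ≤ d) : Og (-d) (phi ι p) := by
  rw [phi_eq ι p d hd]
  refine Og.sum _ _ fun i hi => ?_
  simp only [mem_range] at hi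
  exact (Og.single _ _).mono (by omega)

theorem natDegree_of_Og (p : k[X]) (d : ℕ) (h : Og (-d) (phi ι p)) : p.natDegree ≤ d := by
  rw [natDegree_le_iff_coeff_eq_zero]
  intro n hn
  have := h (-n) (by omega)
  rw [phi_coeff] at this
  exact (map_eq_zero ι).1 this

theorem phi_inj (p : k[X]) (h : phi ι p = 0) : p = 0 := by
  ext n
  have := phi_coeff ι p n
  rw [h, HahnSeries.coeff_zero] at this
  rw [coeff_zero]
  exact (map_eq_zero ι).1 this.symm

def xq (E : Type) [Field E] (q ν : ℕ) : LaurentSeries E := HahnSeries.single ((q ^ ν : ℕ) : ℤ) 1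

theorem xq_pow (q ν n : ℕ) : xq E q ν ^ n = HahnSeries.single ((n * q ^ ν : ℕ) : ℤ) 1 := by
  rw [xq, HahnSeries.single_pow]; simp

theorem xq_th (q ν : ℕ) : xq E q ν * th E ^ (q ^ ν) = 1 := by
  rw [xq, th_pow, HahnSeries.single_mul_single]; simp

def ev (q ν : ℕ) : k[X][X] →+* LaurentSeries E := eval₂RingHom (phi ι) (xq E q ν)

theorem ev_C (q ν : ℕ) (p : k[X]) : ev ι q ν (C p) = phi ι p := by simp [ev]
theorem ev_X (q ν : ℕ) : ev ι q ν X = xq E q ν := by simp [ev]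
theorem phi_X : phi ι X = th E := by simp [phi]
theorem phi_C (c : k) : phi ι (C c) = HahnSeries.C (ι c) := by simp [phi]

theorem ev_expand (q ν : ℕ) (p : k[X][X]) : ev ι q ν (expand _ q p) = ev ι q (ν + 1) p := by
  simp only [ev, coe_eval₂RingHom, expand_eq_comp_X_pow]
  rw [eval₂_comp]
  simp only [eval₂_X_pow]
  congr 1
  rw [xq_pow, xq]
  congr 2
  ring

end Og

def Tp (q W : ℕ) (B : List (ℕ × k)) : k[X][X] :=
  C (C (chL B)) * X ^ (q * wtL B) * (1 - C X * X ^ q) ^ (W - wtL B)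

def Np (q W : ℕ) : ℕ → List (ℕ × k) → k[X][X]
  | 0, B => if B = [] then 1 else 0
  | M + 1, B => Tp q W B * expand _ q (Np q W M B) +
      if B ≠ [] then Tp q W B.tail * expand _ q (Np q W M B.tail) else 0

theorem Tp_map (q W : ℕ) (B : List (ℕ × k)) :
    (Tp q W B).map constantCoeff = C (chL B) * X ^ (q * wtL B) := by
  simp [Tp]

theorem Np_map {q W : ℕ} (M : ℕ) (B : List (ℕ × k)) : (Np q W M B).map constantCoeff = Nb q M B := by
  induction M generalizing B with
  | zero => simp only [Np, Nb]; split_ifs <;> simp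
  | succ M ih =>
    simp only [Np, Nb]
    split_ifs
    · simp only [Polynomial.map_add, Polynomial.map_mul, Tp_map, map_expand, ih, map_add, map_mul, expand_C,
        map_pow, expand_X, pow_mul]
    · simp only [Polynomial.map_add, Polynomial.map_mul, Tp_map, map_expand, ih, map_add, map_mul, expand_C,
        map_pow, expand_X, pow_mul, Polynomial.map_zero, map_zero]

theorem digits {E : Type} [Field E] (ι : k →+* E) (q ν : ℕ) (hq : 2 ≤ q) (J : ℕ) :
    ∀ ρ : k[X], ρ.natDegree < (J + 1) * q ^ ν → ∃ P : k[X][X], P.natDegree ≤ J ∧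
      (∀ i, (P.coeff i).natDegree < q ^ ν) ∧ ev ι q ν P * th E ^ (J * q ^ ν) = phi ι ρ := by
  have hQ : 0 < q ^ ν := Nat.pow_pos (by omega)
  induction J with
  | zero =>
    intro ρ hρ
    refine ⟨C ρ, by simp, fun i => ?_, by simp [ev_C]⟩
    rw [coeff_C]; split_ifs
    · simpa using hρ
    · simpa using hQ
  | succ J ih =>
    intro ρ hρ
    have hm : (X ^ q ^ ν : k[X]).Monic := monic_X_pow _
    obtain ⟨P, h1, h2, h3⟩ := ih (ρ /ₘ X ^ q ^ ν) (by
      rw [natDegree_divByMonic _ hm, natDegree_X_pow]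
      have : (J + 1 + 1) * q ^ ν = (J + 1) * q ^ ν + q ^ ν := by ring
      have : 0 < (J + 1) * q ^ ν := by positivity
      omega)
    refine ⟨P + C (ρ %ₘ X ^ q ^ ν) * X ^ (J + 1), ?_, ?_, ?_⟩
    · refine (natDegree_add_le _ _).trans (max_le (by omega) (natDegree_C_mul_X_pow_le _ _))
    · intro i
      rw [coeff_add, coeff_C_mul_X_pow]
      split_ifs with h
      · subst h
        rw [coeff_eq_zero_of_natDegree_lt (by omega), zero_add]
        have h5 := natDegree_modByMonic_lt ρ hm (by
          intro h
          have := congrArg natDegree h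
          rw [natDegree_X_pow, natDegree_one] at this
          omega)
        rwa [natDegree_X_pow] at h5
      · rw [add_zero]; exact h2 i
    · conv_rhs => rw [← modByMonic_add_div ρ (X ^ q ^ ν)]
      have h4 : xq E q ν ^ (J + 1) * th E ^ ((J + 1) * q ^ ν) = 1 := by
        rw [mul_comm (J + 1) (q ^ ν), pow_mul, ← mul_pow, xq_th, one_pow]
      rw [map_add, map_add, map_mul, map_mul, map_pow, map_pow, ev_C, ev_X, ← h3, phi_X]
      have h6 : (J + 1) * q ^ ν = J * q ^ ν + q ^ ν := by ring
      calc _ = ev ι q ν P * th E ^ ((J + 1) * q ^ ν) + (phi ι) (ρ %ₘ X ^ q ^ ν) *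
            (xq E q ν ^ (J + 1) * th E ^ ((J + 1) * q ^ ν)) := by ring
        _ = _ := by rw [h4, h6, pow_add]; ring

/-- the values -/
structure Vals {E : Type} [Field E] (ι : k →+* E) (q W : ℕ) (I : Finset (List (ℕ × k)))
    (V : ℕ → List (ℕ × k) → LaurentSeries E) : Prop where
  nil : ∀ ν, V ν [] = 1
  og : ∀ ν B, B ∈ I → Og 0 (V ν B)
  recur : ∀ ν B, B ∈ I → ev ι q ν ((1 - C X * X ^ q) ^ W) * V ν B =
    ev ι q ν (Tp q W B) * V (ν + 1) B +
      if B ≠ [] then ev ι q ν (Tp q W B.tail) * V (ν + 1) B.tail else 0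

section Lift
variable {E : Type} [Field E] {ι : k →+* E} {q W : ℕ} {I : Finset (List (ℕ × k))}
    {V : ℕ → List (ℕ × k) → LaurentSeries E}

theorem Tp_nil : Tp (k := k) q W [] = (1 - C X * X ^ q) ^ W := by simp [Tp, chL, wtL]

theorem Tp_Og (ν : ℕ) (hq : 2 ≤ q) (B : List (ℕ × k)) : Og ((wtL B * q ^ (ν + 1) : ℕ) : ℤ) (ev ι q ν (Tp q W B)) := by
  unfold Tp
  rw [map_mul, map_mul, map_pow, map_pow, map_sub, map_mul, map_pow, ev_C, ev_C, ev_X, map_one, phi_X, phi_C,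
    xq_pow, xq_pow]
  have h1 : Og 0 (HahnSeries.C (ι (chL B)) : LaurentSeries E) := Og.single 0 _
  have h2 : Og 0 (1 - th E * HahnSeries.single ((q * q ^ ν : ℕ) : ℤ) 1) := by
    refine Og.one.sub ?_
    have := (Og.single (-1) (1 : E)).mul (Og.single ((q * q ^ ν : ℕ) : ℤ) (1 : E))
    refine this.mono ?_
    have : 0 < q * q ^ ν := by positivity
    omega
  have h3 := (h1.mul (Og.single ((q * wtL B * q ^ ν : ℕ) : ℤ) (1 : E))).mul (h2.pow (W - wtL B))
  refine h3.mono (le_of_eq ?_)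
  push_cast; ring

theorem delta_Og (hq : 2 ≤ q) (hI : Idx q W I) (hV : Vals ι q W I V) (M : ℕ) : ∀ ν, ∀ B ∈ I,
    Og ((M * q ^ ν : ℕ) : ℤ) (V ν B * ev ι q ν (Np q W M []) - ev ι q ν (Np q W M B)) := by
  induction M with
  | zero =>
    intro ν B hB
    simp only [Np]
    have h1 := hV.og ν B hB
    split_ifs
    · simpa using h1.sub Og.one
    · simpa using h1
    · simp_all
    · simp_all
  | succ M ih =>
    intro ν B hB
    have e1 : Np (k := k) q W (M + 1) [] = (1 - C X * X ^ q) ^ W * expand _ q (Np q W M []) := by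
      simp [Np, Tp_nil]
    have key : ∀ D ∈ I, Og (((M + 1) * q ^ ν : ℕ) : ℤ) (ev ι q ν (Tp q W D) *
        (V (ν + 1) D * ev ι q (ν + 1) (Np q W M []) - ev ι q (ν + 1) (Np q W M D))) := by
      intro D hD
      by_cases h : D = []
      · subst h
        rw [hV.nil, one_mul, sub_self, mul_zero]; exact Og.zero _
      · have hw := wtL_pos (hI.pos D hD) h
        refine ((Tp_Og (ι := ι) (W := W) ν hq D).mul (ih (ν + 1) D hD)).mono ?_
        rw [← Nat.cast_add, Nat.cast_le, ← add_mul]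
        apply Nat.mul_le_mul
        · omega
        · exact Nat.pow_le_pow_right (by omega) (by omega)
    have e2 : V ν B * ev ι q ν (Np q W (M + 1) []) - ev ι q ν (Np q W (M + 1) B) =
        ev ι q ν (Tp q W B) *
        (V (ν + 1) B * ev ι q (ν + 1) (Np q W M []) - ev ι q (ν + 1) (Np q W M B)) +
        if B ≠ [] then ev ι q ν (Tp q W B.tail) *
        (V (ν + 1) B.tail * ev ι q (ν + 1) (Np q W M []) - ev ι q (ν + 1) (Np q W M B.tail)) else 0 := by
      rw [e1, map_mul, ev_expand]
      have := hV.recur ν B hB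
      rw [← mul_assoc, mul_comm (V ν B), this, Np]
      split_ifs
      · rw [map_add, map_mul, map_mul, ev_expand, ev_expand]; ring
      · rw [map_add, map_mul, ev_expand, map_zero]; ring
    rw [e2]
    refine (key B hB).add ?_
    split_ifs
    · exact key _ (hI.tail B hB)
    · exact Og.zero _

end Lift

section Lift2
variable {E : Type} [Field E] {ι : k →+* E} {q W : ℕ} {I : Finset (List (ℕ × k))}
    {V : ℕ → List (ℕ × k) → LaurentSeries E}

theorem Ysum_ne {R : Type} [AddCommMonoid R] (I : Finset (List (ℕ × k))) (r : List (ℕ × k) → R)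
    (h : ∃ B ∈ I, r B ≠ 0) : ∃ B ∈ I, Ysum I r B ≠ 0 := by
  obtain ⟨B0, hB0, h0⟩ := h
  obtain ⟨B, hB, hmax⟩ := Finset.exists_max_image (I.filter fun B => r B ≠ 0) List.length
    ⟨B0, mem_filter.2 ⟨hB0, h0⟩⟩
  rw [mem_filter] at hB
  refine ⟨B, hB.1, ?_⟩
  unfold Ysum
  rw [sum_eq_zero, add_zero]
  · exact hB.2
  · intro D hD
    simp only [mem_filter] at hD
    by_contra hne
    have := hmax D (mem_filter.2 ⟨hD.1, hne⟩)
    obtain ⟨x, hx⟩ := wtL_le_tail hD.2.1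
    rw [hx, hD.2.2] at this
    simp at this

theorem th_ev_Tp (ν : ℕ) (C0 : List (ℕ × k)) (hC : wtL C0 ≤ W) :
    th E ^ (W * q ^ (ν + 1)) * ev ι q ν (Tp q W C0) =
      phi ι (C (chL C0) * (X ^ q ^ (ν + 1) - X) ^ (W - wtL C0)) := by
  have h1 : xq E q ν ^ q * th E ^ q ^ (ν + 1) = 1 := by
    rw [pow_succ, pow_mul, ← mul_pow, xq_th, one_pow]
  unfold Tp
  simp only [map_mul, map_pow, map_sub, ev_C, ev_X, map_one, phi_X, phi_C]
  have h2 : th E ^ (W * q ^ (ν + 1)) = (th E ^ q ^ (ν + 1)) ^ wtL C0 * (th E ^ q ^ (ν + 1)) ^ (W - wtL C0) := by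
    rw [← pow_add, Nat.add_sub_cancel' hC, ← pow_mul, mul_comm]
  rw [h2, pow_mul]
  calc _ = HahnSeries.C (ι (chL C0)) * (xq E q ν ^ q * th E ^ q ^ (ν + 1)) ^ wtL C0 *
        (th E ^ q ^ (ν + 1) - th E * (xq E q ν ^ q * th E ^ q ^ (ν + 1))) ^ (W - wtL C0) := by
        rw [mul_pow, show th E ^ q ^ (ν + 1) - th E * (xq E q ν ^ q * th E ^ q ^ (ν + 1)) =
          (th E ^ q ^ (ν + 1)) * (1 - th E * xq E q ν ^ q) by ring, mul_pow]
        ring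
    _ = _ := by rw [h1]; simp

theorem lift_rho (hq : 2 ≤ q) (hI : Idx q W I) (hV : Vals ι q W I V) (ρ0 : List (ℕ × k) → k[X])
    (hne : ∃ B ∈ I, ρ0 B ≠ 0) (hrel : ∑ B ∈ I, phi ι (ρ0 B) * V 0 B = 0) (c : ℕ) (hcW : 2 * W ≤ c)
    (hc : ∀ B ∈ I, (ρ0 B).natDegree ≤ c) :
    ∀ ν : ℕ, ∃ ρ : List (ℕ × k) → k[X], (∃ B ∈ I, ρ B ≠ 0) ∧ ∑ B ∈ I, phi ι (ρ B) * V ν B = 0 ∧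
      ∀ B ∈ I, (ρ B).natDegree ≤ c * q ^ ν := by
  intro ν
  induction ν with
  | zero => exact ⟨ρ0, hne, hrel, by simpa using hc⟩
  | succ ν ih =>
    obtain ⟨ρ, h1, h2, h3⟩ := ih
    have hqq : 2 ≤ q ^ (ν + 1) := le_trans hq (Nat.le_self_pow (by omega) q)
    have hXne : (X ^ q ^ (ν + 1) - X : k[X]) ≠ 0 := by
      intro h
      have := congrArg (fun p => coeff p 1) h
      simp only [coeff_sub, coeff_X_pow, coeff_X_one, coeff_zero] at this
      rw [if_neg (by omega)] at this
      simp at this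
    refine ⟨fun C0 => C (chL C0) * (X ^ q ^ (ν + 1) - X) ^ (W - wtL C0) * Ysum I ρ C0, ?_, ?_, ?_⟩
    · obtain ⟨B, hB, hY⟩ := Ysum_ne I ρ h1
      exact ⟨B, hB, mul_ne_zero (mul_ne_zero (C_ne_zero.2 (chL_ne (hI.ne B hB))) (pow_ne_zero _ hXne)) hY⟩
    · have e := regroup I hI.tail (fun B => phi ι (ρ B))
        (fun B => th E ^ (W * q ^ (ν + 1)) * ev ι q ν (Tp q W B) * V (ν + 1) B)
      have hL : ∑ B ∈ I, phi ι (ρ B) * (th E ^ (W * q ^ (ν + 1)) * ev ι q ν (Tp q W B) * V (ν + 1) B +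
          if B ≠ [] then th E ^ (W * q ^ (ν + 1)) * ev ι q ν (Tp q W B.tail) * V (ν + 1) B.tail else 0) =
          (th E ^ (W * q ^ (ν + 1)) * ev ι q ν ((1 - C X * X ^ q) ^ W)) * ∑ B ∈ I, phi ι (ρ B) * V ν B := by
        rw [mul_sum]
        refine sum_congr rfl fun B hB => ?_
        have := hV.recur ν B hB
        calc _ = phi ι (ρ B) * th E ^ (W * q ^ (ν + 1)) * (ev ι q ν (Tp q W B) * V (ν + 1) B +
              if B ≠ [] then ev ι q ν (Tp q W B.tail) * V (ν + 1) B.tail else 0) := by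
                split_ifs <;> ring
          _ = _ := by rw [← this]; ring
      rw [hL, h2, mul_zero] at e
      rw [e]
      refine sum_congr rfl fun B hB => ?_
      have hY : Ysum I (fun B => phi ι (ρ B)) B = phi ι (Ysum I ρ B) := by
        unfold Ysum; rw [map_add, map_sum]
      rw [hY, map_mul, ← th_ev_Tp ν B (hI.wt B hB)]
      ring
    · intro B hB
      have hYd : (Ysum I ρ B).natDegree ≤ c * q ^ ν := by
        unfold Ysum
        refine (natDegree_add_le _ _).trans (max_le (h3 B hB) ?_)
        refine natDegree_sum_le_of_forall_le _ _ fun D hD => h3 D (mem_filter.1 hD).1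
      have hd1 : (X ^ q ^ (ν + 1) - X : k[X]).natDegree ≤ q ^ (ν + 1) := by
        refine (natDegree_sub_le _ _).trans (max_le (natDegree_X_pow_le _) ?_)
        exact natDegree_X_le.trans (by omega)
      have hd2 : ((X ^ q ^ (ν + 1) - X : k[X]) ^ (W - wtL B)).natDegree ≤ W * q ^ (ν + 1) :=
        natDegree_pow_le.trans (Nat.mul_le_mul (Nat.sub_le _ _) hd1)
      refine natDegree_mul_le.trans ?_
      refine (Nat.add_le_add ((natDegree_C_mul_le _ _).trans hd2) hYd).trans ?_
      have : 2 * q ^ ν ≤ q ^ (ν + 1) := by rw [pow_succ, mul_comm]; exact Nat.mul_le_mul_left _ hq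
      have h5 : 2 * (W * q ^ (ν + 1)) ≤ c * q ^ (ν + 1) := by
        rw [← mul_assoc]; exact Nat.mul_le_mul_right _ hcW
      have h6 : 2 * (c * q ^ ν) ≤ c * q ^ (ν + 1) := by
        rw [mul_left_comm]; exact Nat.mul_le_mul_left _ this
      omega

/-- the approximations kappa -/
theorem kappa (ν : ℕ) (E0 : k[X][X]) (c0 n0 : ℕ) 
    (hdeg : ∀ m, (E0.coeff m).natDegree < q ^ ν + c0) 
    (hO : Og ((n0 * q ^ ν : ℕ) : ℤ) (ev ι q ν E0)) :
    ∃ κ : k[X][X], κ.natDegree ≤ n0 ∧ (∀ n, (κ.coeff n).natDegree ≤ c0) ∧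
      X ^ (n0 + 1) ∣ E0 - (1 - C (X ^ q ^ ν) * X) * κ := by
  set Q := q ^ ν with hQ
  let κf : ℕ → k[X] := fun n => ∑ m ∈ range (n + 1), E0.coeff m * X ^ ((n - m) * Q)
  have hκd : ∀ n ≤ n0, (κf n).natDegree ≤ c0 := by
    intro n hn
    apply natDegree_of_Og ι
    have h0 : ev ι q ν E0 = ∑ m ∈ range (n + 1 + (E0.natDegree + 1)), phi ι (E0.coeff m) * xq E q ν ^ m := by
      rw [ev, coe_eval₂RingHom, eval₂_eq_sum_range' _ (show E0.natDegree < n + 1 + (E0.natDegree + 1) by omega)]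
    rw [sum_range_add] at h0
    have h1 : phi ι (κf n) = th E ^ (n * Q) * (ev ι q ν E0 -
        ∑ m ∈ range (E0.natDegree + 1), phi ι (E0.coeff (n + 1 + m)) * xq E q ν ^ (n + 1 + m)) := by
      rw [h0, add_sub_cancel_right, mul_sum, map_sum]
      refine sum_congr rfl fun m hm => ?_
      simp only [mem_range] at hm
      rw [map_mul, map_pow, phi_X]
      have h2 : n * Q = m * Q + (n - m) * Q := by rw [← add_mul]; congr 1; omega
      have h3 : xq E q ν ^ m * th E ^ (m * Q) = 1 := by
        rw [mul_comm m, pow_mul, ← mul_pow, xq_th, one_pow]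
      rw [h2, pow_add]
      calc _ = phi ι (E0.coeff m) * th E ^ ((n - m) * Q) * (xq E q ν ^ m * th E ^ (m * Q)) := by
            rw [h3, mul_one]
        _ = _ := by ring
    rw [h1, th_pow]
    have h4 : Og ((n * Q : ℕ) - c0 : ℤ) (ev ι q ν E0 -
        ∑ m ∈ range (E0.natDegree + 1), phi ι (E0.coeff (n + 1 + m)) * xq E q ν ^ (n + 1 + m)) := by
      refine Og.sub (hO.mono ?_) (Og.sum _ _ fun m _ => ?_)
      · have : n * Q ≤ n0 * Q := Nat.mul_le_mul_right _ hn
        omega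
      · rw [xq_pow]
        refine ((phi_Og ι _ (Q + c0) (hdeg _).le).mul (Og.single _ _)).mono ?_
        have : (n + 1 + m) * Q = n * Q + Q + m * Q := by ring
        rw [← hQ, this]
        push_cast
        have : (0 : ℤ) ≤ m * Q := by positivity
        linarith
    have h5 := (Og.single (-(n * Q : ℕ) : ℤ) (1 : E)).mul h4
    exact h5.mono (by omega)
  refine ⟨∑ n ∈ range (n0 + 1), C (κf n) * X ^ n, ?_, ?_, ?_⟩
  · refine natDegree_sum_le_of_forall_le _ _ fun n hn => ?_
    simp only [mem_range] at hn
    exact (natDegree_C_mul_X_pow_le _ _).trans (by omega)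
  · intro n
    rw [finsetSum_coeff]
    simp only [coeff_C_mul_X_pow]
    rw [Finset.sum_ite_eq]
    split_ifs with h
    · simp only [mem_range] at h
      exact hκd n (by omega)
    · simp
  · rw [X_pow_dvd_iff]
    intro d hd
    have hco : ∀ d < n0 + 1, (∑ n ∈ range (n0 + 1), C (κf n) * X ^ n).coeff d = κf d := by
      intro d hd
      rw [finsetSum_coeff]
      simp only [coeff_C_mul_X_pow]
      rw [Finset.sum_ite_eq, if_pos (mem_range.2 hd)]
    rw [sub_mul, one_mul, mul_assoc, coeff_sub, coeff_sub, coeff_C_mul, hco d hd]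
    cases d with
    | zero => simp [κf]
    | succ d =>
      rw [coeff_X_mul, hco d (by omega)]
      simp only [κf]
      rw [sum_range_succ _ (d + 1), mul_sum]
      have : ∑ m ∈ range (d + 1), X ^ Q * (E0.coeff m * X ^ ((d - m) * Q)) =
          ∑ m ∈ range (d + 1), E0.coeff m * X ^ ((d + 1 - m) * Q) := by
        refine sum_congr rfl fun m hm => ?_
        simp only [mem_range] at hm
        have : (d + 1 - m) * Q = (d - m) * Q + Q := by
          rw [show d + 1 - m = d - m + 1 by omega, add_mul, one_mul]
        rw [this, pow_add]; ring
      rw [this]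
      simp

/-- removing powers of theta -/
theorem strip (J n0 M : ℕ) : ∀ d : ℕ, ∀ R : List (ℕ × k) → k[X][X],
    (∀ B ∈ I, (R B).natDegree ≤ J) → (∃ B ∈ I, ∃ i, (R B).coeff i ≠ 0 ∧ ((R B).coeff i).natDegree = d) →
    X ^ (n0 + 1) ∣ ∑ B ∈ I, R B * Np q W M B →
    ∃ R' : List (ℕ × k) → k[X], (∀ B ∈ I, (R' B).natDegree ≤ J) ∧ (∃ B ∈ I, R' B ≠ 0) ∧
      X ^ (n0 + 1) ∣ ∑ B ∈ I, R' B * Nb q M B := by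
  intro d
  induction d with
  | zero | succ d ih => ?_
  all_goals
    intro R hJ hB hdv
    by_cases hall : ∃ B ∈ I, (R B).map (constantCoeff (R := k)) ≠ 0
    · refine ⟨fun B => (R B).map constantCoeff, fun B hB => natDegree_map_le.trans (hJ B hB), hall, ?_⟩
      have := Polynomial.map_dvd (constantCoeff (R := k)) hdv
      simpa only [Polynomial.map_pow, map_X, Polynomial.map_sum, Polynomial.map_mul, Np_map] using this
    · push Not at hall
      have hX : ∀ B ∈ I, ∃ S, R B = C X * S := by
        intro B hB
        have : C X ∣ R B := by
          rw [C_dvd_iff_dvd_coeff]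
          intro i
          rw [X_dvd_iff]
          have := congrArg (fun p => coeff p i) (hall B hB)
          simpa using this
        exact this
      choose! S hS using hX
      obtain ⟨B, hBI, i, h1, h2⟩ := hB
      rw [hS B hBI, coeff_C_mul] at h1 h2
      have h3 : (S B).coeff i ≠ 0 := right_ne_zero_of_mul h1
      rw [natDegree_X_mul h3] at h2
      first
      | (exfalso; omega)
      | (refine ih S ?_ ⟨B, hBI, i, h3, by omega⟩ ?_
         · intro B hB
           have h := hJ B hB
           rw [hS B hB, natDegree_C_mul X_ne_zero] at h
           exact h
         · have e : ∑ B ∈ I, R B * Np q W M B = C X * ∑ B ∈ I, S B * Np q W M B := by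
             rw [mul_sum]
             refine sum_congr rfl fun B hB => ?_
             rw [hS B hB, mul_assoc]
           rw [e, X_pow_dvd_iff] at hdv
           rw [X_pow_dvd_iff]
           intro d hd
           have := hdv d hd
           rw [coeff_C_mul] at this
           exact (mul_eq_zero.1 this).resolve_left X_ne_zero)

end Lift2

section Main1
variable {E : Type} [Field E] {ι : k →+* E} {q W : ℕ} {I : Finset (List (ℕ × k))}
    {V : ℕ → List (ℕ × k) → LaurentSeries E}

theorem ev_Og (ν : ℕ) (P : k[X][X]) (hP : ∀ i, (P.coeff i).natDegree < q ^ ν) :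
    Og (-(q ^ ν : ℕ) : ℤ) (ev ι q ν P) := by
  rw [ev, coe_eval₂RingHom, eval₂_eq_sum_range]
  refine Og.sum _ _ fun i _ => ?_
  rw [xq_pow]
  refine ((phi_Og ι _ (q ^ ν) (hP i).le).mul (Og.single _ _)).mono ?_
  have : (0 : ℤ) ≤ ((i * q ^ ν : ℕ) : ℤ) := by positivity
  omega

theorem coeff_bound (I : Finset (List (ℕ × k))) (N : List (ℕ × k) → k[X][X]) :
    ∃ c0, ∀ B ∈ I, ∀ i, ((N B).coeff i).natDegree ≤ c0 := by
  refine ⟨∑ B ∈ I, ∑ i ∈ (N B).support, ((N B).coeff i).natDegree, fun B hB i => ?_⟩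
  by_cases hi : i ∈ (N B).support
  · refine le_trans ?_ (Finset.single_le_sum (f := fun B => ∑ i ∈ (N B).support, ((N B).coeff i).natDegree)
      (fun _ _ => Nat.zero_le _) hB)
    exact Finset.single_le_sum (f := fun i => ((N B).coeff i).natDegree) (fun _ _ => Nat.zero_le _) hi
  · rw [notMem_support_iff.1 hi]; simp

theorem part1 [Finite k] (hq : 2 ≤ q) (hI : Idx q W I) (hV : Vals ι q W I V)
    (ρ0 : List (ℕ × k) → k[X]) (hrel : ∑ B ∈ I, phi ι (ρ0 B) * V 0 B = 0) :
    ∀ B ∈ I, ρ0 B = 0 := by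
  by_contra hcon
  push Not at hcon
  set J : ℕ := 2 * W + ∑ B ∈ I, (ρ0 B).natDegree with hJ
  have hl := lift_rho hq hI hV ρ0 hcon hrel J (by omega) (by
    intro B hB
    have := Finset.single_le_sum (f := fun B => (ρ0 B).natDegree) (fun _ _ => Nat.zero_le _) hB
    omega)
  choose ρ hρ1 hρ2 hρ3 using hl
  have hQ : ∀ ν, 0 < q ^ ν := fun ν => Nat.pow_pos (by omega)
  have hdig : ∀ ν, ∀ B, B ∈ I → ∃ P : k[X][X], P.natDegree ≤ J ∧
      (∀ i, (P.coeff i).natDegree < q ^ ν) ∧ ev ι q ν P * th E ^ (J * q ^ ν) = phi ι (ρ ν B) := by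
    intro ν B hB
    apply digits ι q ν hq
    have := hρ3 ν B hB
    have := hQ ν
    have e : (J + 1) * q ^ ν = J * q ^ ν + q ^ ν := by ring
    omega
  choose! P hP1 hP2 hP3 using hdig
  obtain ⟨n0, hn0⟩ := exists_level hq hI (J + 1)
  obtain ⟨c0, hc0⟩ := coeff_bound I (Np q W (n0 + 1))
  let E0 : ℕ → k[X][X] := fun ν => ∑ B ∈ I, P ν B * Np q W (n0 + 1) B
  have hdeg : ∀ ν m, ((E0 ν).coeff m).natDegree < q ^ ν + c0 := by
    intro ν m
    have h0 := hQ ν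
    suffices ((E0 ν).coeff m).natDegree ≤ (q ^ ν - 1) + c0 by omega
    simp only [E0]
    rw [finsetSum_coeff]
    refine natDegree_sum_le_of_forall_le _ _ fun B hB => ?_
    rw [coeff_mul]
    refine natDegree_sum_le_of_forall_le _ _ fun p _ => ?_
    refine natDegree_mul_le.trans (Nat.add_le_add ?_ (hc0 B hB _))
    have := hP2 ν B hB p.1
    omega
  have hth : th E ≠ 0 := by
    rw [th, Ne, HahnSeries.single_eq_zero_iff]; exact one_ne_zero
  have hO : ∀ ν, Og ((n0 * q ^ ν : ℕ) : ℤ) (ev ι q ν (E0 ν)) := by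
    intro ν
    have h1 : ∑ B ∈ I, ev ι q ν (P ν B) * V ν B = 0 := by
      have h2 : th E ^ (J * q ^ ν) * ∑ B ∈ I, ev ι q ν (P ν B) * V ν B = 0 := by
        rw [← hρ2 ν, mul_sum]
        refine sum_congr rfl fun B hB => ?_
        rw [← hP3 ν B hB]; ring
      exact (mul_eq_zero.1 h2).resolve_left (pow_ne_zero _ hth)
    have h3 : ev ι q ν (E0 ν) = - ∑ B ∈ I, ev ι q ν (P ν B) *
        (V ν B * ev ι q ν (Np q W (n0 + 1) []) - ev ι q ν (Np q W (n0 + 1) B)) := by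
      simp only [mul_sub, sum_sub_distrib, ← mul_assoc]
      rw [← sum_mul, h1, zero_mul, zero_sub, neg_neg]
      simp only [E0, map_sum, map_mul]
    rw [h3]
    refine (Og.sum _ _ fun B hB => ?_).neg
    refine ((ev_Og ν _ (hP2 ν B hB)).mul (delta_Og hq hI hV (n0 + 1) ν B hB)).mono ?_
    push_cast; linarith
  have hκ := fun ν => kappa (ι := ι) ν (E0 ν) c0 n0 (hdeg ν) (hO ν)
  choose κ hκ1 hκ2 hκ3 using hκ
  let F : ℕ → Fin (n0 + 1) → Fin (c0 + 1) → k := fun ν n i => ((κ ν).coeff n).coeff i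
  obtain ⟨ν, ν', hne, hF⟩ := Finite.exists_ne_map_eq_of_infinite F
  have hκe : κ ν = κ ν' := by
    ext n i
    by_cases hn : n ≤ n0
    · by_cases hi : i ≤ c0
      · exact congrFun (congrFun hF ⟨n, by omega⟩) ⟨i, by omega⟩
      · rw [coeff_eq_zero_of_natDegree_lt, coeff_eq_zero_of_natDegree_lt]
        · have := hκ2 ν' n; omega
        · have := hκ2 ν n; omega
    · rw [coeff_eq_zero_of_natDegree_lt (p := κ ν), coeff_eq_zero_of_natDegree_lt (p := κ ν')]
      · have := hκ1 ν'; omega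
      · have := hκ1 ν; omega
  let R : List (ℕ × k) → k[X][X] := fun B =>
    (1 - C (X ^ q ^ ν') * X) * P ν B - (1 - C (X ^ q ^ ν) * X) * P ν' B
  have hRdeg : ∀ B ∈ I, (R B).natDegree ≤ J + 1 := by
    intro B hB
    have h1 : ∀ Q : ℕ, (1 - C (X ^ Q) * X : k[X][X]).natDegree ≤ 1 := by
      intro Q
      refine (natDegree_sub_le _ _).trans (max_le (by simp) ?_)
      exact (natDegree_C_mul_le _ _).trans natDegree_X_le
    refine (natDegree_sub_le _ _).trans (max_le ?_ ?_)
    · refine natDegree_mul_le.trans ?_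
      have := h1 (q ^ ν'); have := hP1 ν B hB; omega
    · refine natDegree_mul_le.trans ?_
      have := h1 (q ^ ν); have := hP1 ν' B hB; omega
  have hRdvd : X ^ (n0 + 1) ∣ ∑ B ∈ I, R B * Np q W (n0 + 1) B := by
    have e : ∑ B ∈ I, R B * Np q W (n0 + 1) B =
        (1 - C (X ^ q ^ ν') * X) * (E0 ν - (1 - C (X ^ q ^ ν) * X) * κ ν) -
        (1 - C (X ^ q ^ ν) * X) * (E0 ν' - (1 - C (X ^ q ^ ν') * X) * κ ν') := by
      have e1 : ∑ B ∈ I, R B * Np q W (n0 + 1) B =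
        (1 - C (X ^ q ^ ν') * X) * E0 ν - (1 - C (X ^ q ^ ν) * X) * E0 ν' := by
        simp only [R, E0, sub_mul (_ * _), sum_sub_distrib, mul_sum, mul_assoc]
      rw [e1, hκe]; ring
    rw [e]
    exact dvd_sub (Dvd.dvd.mul_left (hκ3 ν) _) (Dvd.dvd.mul_left (hκ3 ν') _)
  by_cases hR : ∃ B ∈ I, R B ≠ 0
  · obtain ⟨B, hB, hRB⟩ := hR
    have : ∃ i, (R B).coeff i ≠ 0 := by
      by_contra! h
      exact hRB (by ext1 i; rw [h i, coeff_zero])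
    obtain ⟨i, hi⟩ := this
    obtain ⟨R', r1, r2, r3⟩ := strip (J + 1) n0 (n0 + 1) _ R hRdeg ⟨B, hB, i, hi, rfl⟩ hRdvd
    obtain ⟨n, hn, hne⟩ := hn0 R' r1 r2 (n0 + 1) (by omega)
    rw [X_pow_dvd_iff] at r3
    exact hne (r3 n (by omega))
  · push Not at hR
    obtain ⟨B, hB, hρB⟩ := hρ1 ν
    apply hρB
    apply phi_inj ι
    rw [← hP3 ν B hB]
    have h1 := congrArg (ev ι q ν) (hR B hB)
    simp only [R, map_sub, map_mul, map_one, ev_C, ev_X, map_pow, phi_X, map_zero] at h1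
    have h2 : 1 - th E ^ q ^ ν * xq E q ν = 0 := by rw [mul_comm, xq_th, sub_self]
    rw [h2, zero_mul, sub_zero] at h1
    have h3 : 1 - th E ^ q ^ ν' * xq E q ν ≠ 0 := by
      intro h
      rw [th_pow, xq, HahnSeries.single_mul_single] at h
      have h4 := congrArg (fun v => HahnSeries.coeff v 0) h
      simp only [HahnSeries.coeff_sub, HahnSeries.coeff_zero] at h4
      rw [HahnSeries.coeff_single_of_ne] at h4
      · simp at h4
      · intro h5
        have h6 : q ^ ν = q ^ ν' := by omega
        exact hne (Nat.pow_right_injective hq h6)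
    rw [(mul_eq_zero.1 h1).resolve_left h3, zero_mul]

end Main1

section Topo
variable {E : Type} [Field E]
open Topology Filter

theorem nonarch : NonarchimedeanAddGroup (LaurentSeries E) where
  is_nonarchimedean := by
    intro U hU
    obtain ⟨γ, hγ⟩ := (Valued.mem_nhds_zero).1 hU
    exact ⟨⟨Valuation.ltAddSubgroup (Valued.v.restrict) γ, Valued.isOpen_ball _ _⟩, hγ⟩

theorem summable_of_Og {S : Type} (f : S → LaurentSeries E)
    (h : ∀ n : ℕ, {x | ¬ Og n (f x)}.Finite) : Summable f := by
  haveI : NonarchimedeanAddGroup (LaurentSeries E) := nonarch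
  refine NonarchimedeanAddGroup.summable_of_tendsto_cofinite_zero ?_
  intro U hU
  obtain ⟨γ, hγ⟩ := (Valued.mem_nhds_zero).1 hU
  rw [Filter.mem_map, Filter.mem_cofinite]
  have hne : MonoidWithZeroHom.ValueGroup₀.embedding γ.1 ≠ 0 := by simp
  obtain ⟨m, hm⟩ : ∃ m : ℤ, MonoidWithZeroHom.ValueGroup₀.embedding γ.1 = WithZero.exp m := ⟨_, (WithZero.exp_log hne).symm⟩
  refine (h (1 - m).toNat).subset ?_
  intro x hx hO
  apply hx
  apply hγ
  show Valued.v.restrict (f x) < γ.1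
  rw [Valuation.restrict_lt_iff_lt_embedding, hm]
  have : Valued.v (f x) ≤ WithZero.exp (-(1-m)) := by
    rw [LaurentSeries.valuation_le_iff_coeff_lt_eq_zero]
    exact hO.mono (by omega)
  refine this.trans_lt ?_
  rw [WithZero.exp_lt_exp]; omega

theorem Og.hasSum {S : Type} {f : S → LaurentSeries E} {a : LaurentSeries E} {n : ℤ} (ha : HasSum f a)
    (h : ∀ x, Og n (f x)) : Og n a := by
  intro i hi
  letI : UniformSpace E := ⊥
  haveI : DiscreteTopology E := ⟨rfl⟩
  have hc := ((LaurentSeries.uniformContinuous_coeff (K := E) i).continuous.tendsto a).comp ha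
  refine tendsto_nhds_unique hc ?_
  refine tendsto_const_nhds.congr ?_
  intro s
  exact (Og.sum s f (fun x _ => h x) i hi).symm

end Topo

section VV
variable {E : Type} [Field E] (q : ℕ)

def lam (ν : ℕ) : LaurentSeries E := th E - th E ^ q ^ (ν + 1)

theorem inv_Og (hq : 2 ≤ q) (ν : ℕ) : Og ((q ^ (ν + 1) : ℕ) : ℤ) ((lam q ν : LaurentSeries E)⁻¹) := by
  have h2 : 1 < q ^ (ν+1) := Nat.one_lt_pow (by omega) (by omega)
  have hc : (lam q ν : LaurentSeries E).coeff (-(q ^ (ν + 1) : ℕ) : ℤ) ≠ 0 := by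
    rw [lam, th_pow, th, HahnSeries.coeff_sub, HahnSeries.coeff_single_of_ne (by omega),
      HahnSeries.coeff_single_same]
    simp
  have hne : (lam q ν : LaurentSeries E) ≠ 0 := by
    intro h; rw [h] at hc; simp at hc
  have ho := HahnSeries.order_le_of_coeff_ne_zero hc
  have := HahnSeries.order_mul hne (inv_ne_zero hne)
  rw [mul_inv_cancel₀ hne, HahnSeries.order_one] at this
  intro i hi
  exact HahnSeries.coeff_eq_zero_of_lt_order (by omega)

theorem lam_ne (hq : 2 ≤ q) (ν : ℕ) : (lam q ν : LaurentSeries E) ≠ 0 := by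
  have h2 : 1 < q ^ (ν+1) := Nat.one_lt_pow (by omega) (by omega)
  intro h
  have hc : (lam q ν : LaurentSeries E).coeff (-(q ^ (ν + 1) : ℕ) : ℤ) ≠ 0 := by
    rw [lam, th_pow, th, HahnSeries.coeff_sub, HahnSeries.coeff_single_of_ne (by omega),
      HahnSeries.coeff_single_same]
    simp
  rw [h] at hc; simp at hc

variable (ι : k →+* E)

def Gt (ν : ℕ) (x : ℕ × k) (d : ℕ) : LaurentSeries E :=
  HahnSeries.C (ι x.2 ^ d) / (∏ i ∈ range d, lam q (ν + i)) ^ x.1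

theorem Gt_zero (ν : ℕ) (x : ℕ × k) : Gt q ι ν x 0 = 1 := by simp [Gt]

theorem Gt_succ (ν : ℕ) (x : ℕ × k) (d : ℕ) :
    Gt q ι ν x (d + 1) = HahnSeries.C (ι x.2) * (lam q ν)⁻¹ ^ x.1 * Gt q ι (ν + 1) x d := by
  rw [Gt, Gt, prod_range_succ', pow_succ, map_mul, mul_pow, add_zero]
  have : ∀ i, ν + (i + 1) = ν + 1 + i := fun i => by ring
  rw [prod_congr rfl fun i _ => by rw [this i]]
  rw [div_eq_mul_inv, div_eq_mul_inv, mul_inv, inv_pow]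
  ring

theorem Gt_Og (hq : 2 ≤ q) (x : ℕ × k) (hx : 0 < x.1) (d : ℕ) : ∀ ν, Og (d : ℤ) (Gt q ι ν x d) := by
  induction d with
  | zero => intro ν; rw [Gt_zero]; exact Og.one
  | succ d ih =>
    intro ν
    rw [Gt_succ]
    have h0 : Og 0 (HahnSeries.C (ι x.2) : LaurentSeries E) := Og.single 0 _
    have h1 := ((inv_Og (E := E) q hq ν).pow' x.1)
    have h2 := (h0.mul h1).mul (ih (ν + 1))
    refine h2.mono ?_
    have : 1 ≤ q ^ (ν+1) := Nat.one_le_pow _ _ (by omega)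
    have : 1 ≤ x.1 * q ^ (ν+1) := Nat.mul_pos hx (by omega)
    push_cast
    have : (1:ℤ) ≤ x.1 * q ^ (ν+1) := by exact_mod_cast this
    omega

abbrev SS (n : ℕ) : Type := {g : Fin n → ℕ // StrictMono g}

def tm (ν : ℕ) (B : List (ℕ × k)) (g : SS B.length) : LaurentSeries E :=
  ∏ i : Fin B.length, Gt q ι ν (B.get i) (g.1 i)

def VV (ν : ℕ) (B : List (ℕ × k)) : LaurentSeries E := ∑' g, tm q ι ν B g

def sh {n : ℕ} (g : SS n) : SS n := ⟨fun i => g.1 i + 1, fun i j h => by have := g.2 h; simp only; omega⟩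

def sh0 {n : ℕ} (g : SS n) : SS (n + 1) := ⟨Fin.cons 0 (sh g).1, by
  intro i j h
  induction j using Fin.cases with
  | zero => exact absurd h (by simp)
  | succ j =>
    induction i using Fin.cases with
    | zero => simp [sh]
    | succ i => simpa using (sh g).2 (by simpa using h)⟩

theorem sh_bij (n : ℕ) : Function.Bijective
    (Sum.elim (sh : SS (n+1) → SS (n+1)) (sh0 : SS n → SS (n+1))) := by
  constructor
  · rintro (g | g) (g' | g') h
    · congr 1
      ext i
      have := congrFun (congrArg Subtype.val h) i
      simpa [sh] using this
    · have := congrFun (congrArg Subtype.val h) 0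
      simp [sh, sh0] at this
    · have := congrFun (congrArg Subtype.val h) 0
      simp [sh, sh0] at this
    · congr 1
      ext i
      have := congrFun (congrArg Subtype.val h) i.succ
      simpa [sh, sh0] using this
  · intro g
    by_cases h0 : g.1 0 = 0
    · have hp : ∀ i : Fin n, 0 < g.1 i.succ := fun i => by
        have := g.2 (Fin.succ_pos i); omega
      refine ⟨Sum.inr ⟨fun i => g.1 i.succ - 1, ?_⟩, ?_⟩
      · intro i j h
        have := g.2 (Fin.succ_lt_succ_iff.2 h)
        have := hp i
        simp only; omega
      · ext i
        induction i using Fin.cases with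
        | zero => simp [sh0, h0]
        | succ i => have := hp i; simp [sh0, sh]; omega
    · have hp : ∀ i, 0 < g.1 i := fun i => by
        have := g.2.monotone (Fin.zero_le i); omega
      refine ⟨Sum.inl ⟨fun i => g.1 i - 1, ?_⟩, ?_⟩
      · intro i j h
        have := g.2 h
        have := hp i
        simp only; omega
      · ext i
        have := hp i; simp [sh]; omega

/-- multiplier -/
def mu (ν : ℕ) (B : List (ℕ × k)) : LaurentSeries E :=
  (B.map fun a => HahnSeries.C (ι a.2) * (lam q ν)⁻¹ ^ a.1).prod

theorem tm_sh (ν : ℕ) (B : List (ℕ × k)) (g : SS B.length) :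
    tm q ι ν B (sh g) = mu q ι ν B * tm q ι (ν + 1) B g := by
  rw [tm, tm, mu]
  have hl : ∀ f : ℕ × k → LaurentSeries E, (B.map f).prod = ∏ i : Fin B.length, f (B.get i) := by
    intro f
    conv_lhs => rw [← List.ofFn_get B]
    rw [List.map_ofFn, List.prod_ofFn]
    rfl
  rw [hl, ← prod_mul_distrib]
  refine prod_congr rfl fun i _ => ?_
  exact Gt_succ q ι ν _ _

theorem tm_sh0 (ν : ℕ) (a : ℕ × k) (B : List (ℕ × k)) (g : SS B.length) :
    tm q ι ν (a :: B) (sh0 g) = tm q ι ν B (sh g) := by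
  rw [tm, tm]
  erw [Fin.prod_univ_succ]
  simp [sh0, Gt_zero]

theorem tm_Og (hq : 2 ≤ q) (ν : ℕ) (B : List (ℕ × k)) (hB : ∀ x ∈ B, 0 < x.1) (g : SS B.length) :
    Og ((∑ i, g.1 i : ℕ) : ℤ) (tm q ι ν B g) := by
  rw [tm]
  have : ∀ s : Finset (Fin B.length), Og ((∑ i ∈ s, g.1 i : ℕ) : ℤ) (∏ i ∈ s, Gt q ι ν (B.get i) (g.1 i)) := by
    intro s
    induction s using Finset.induction_on with
    | empty => simpa using Og.one
    | insert a s ha ih =>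
      rw [sum_insert ha, prod_insert ha]
      push_cast
      have := (Gt_Og q ι hq (B.get a) (hB _ (List.get_mem _ _)) (g.1 a) ν).mul ih
      push_cast at this
      exact this
  exact this univ

theorem tm_summable (hq : 2 ≤ q) (ν : ℕ) (B : List (ℕ × k)) (hB : ∀ x ∈ B, 0 < x.1) :
    Summable (tm q ι ν B) := by
  refine summable_of_Og _ fun n => ?_
  have hf : {f : Fin B.length → ℕ | ∀ i, f i ∈ Finset.range n}.Finite := by
    have := Set.Finite.pi' (fun (i : Fin B.length) => (Finset.range n).finite_toSet)
    simpa using this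
  refine (hf.preimage (f := fun g : SS B.length => g.1) Subtype.val_injective.injOn).subset ?_
  intro g hg i
  by_contra hi
  apply hg
  refine (tm_Og q ι hq ν B hB g).mono ?_
  have : g.1 i ≤ ∑ i, g.1 i := Finset.single_le_sum (f := fun i => g.1 i) (fun _ _ => Nat.zero_le _) (mem_univ i)
  simp at hi
  exact_mod_cast hi.trans this

theorem VV_nil (ν : ℕ) : VV q ι ν [] = 1 := by
  haveI : Unique (SS ([] : List (ℕ × k)).length) :=
    ⟨⟨⟨fun i => i.elim0, fun i => i.elim0⟩⟩, fun g => by ext i; exact i.elim0⟩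
  rw [VV, tsum_eq_single default]
  · simp [tm]
  · intro b hb; exact absurd (Subsingleton.elim _ _) hb

theorem VV_cons (hq : 2 ≤ q) (ν : ℕ) (a : ℕ × k) (B : List (ℕ × k)) (hB : ∀ x ∈ a :: B, 0 < x.1) :
    VV q ι ν (a :: B) = mu q ι ν (a :: B) * VV q ι (ν + 1) (a :: B) + mu q ι ν B * VV q ι (ν + 1) B := by
  have hB' : ∀ x ∈ B, 0 < x.1 := fun x hx => hB x (List.mem_cons_of_mem _ hx)
  have s1 := ((tm_summable q ι hq (ν+1) (a :: B) hB).hasSum).mul_left (mu q ι ν (a :: B))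
  have s2 := ((tm_summable q ι hq (ν+1) B hB').hasSum).mul_left (mu q ι ν B)
  have : HasSum (tm q ι ν (a :: B) ∘ (Equiv.ofBijective _ (sh_bij B.length))) (mu q ι ν (a :: B) * VV q ι (ν + 1) (a :: B) + mu q ι ν B * VV q ι (ν + 1) B) := by
    refine HasSum.sum ?_ ?_
    · convert! s1 using 1
      funext g
      exact tm_sh q ι ν (a :: B) g
    · convert! s2 using 1
      funext g
      exact (tm_sh0 q ι ν a B g).trans (tm_sh q ι ν B g)
  exact ((Equiv.hasSum_iff _).1 this).tsum_eq

theorem lam_inv (hq : 2 ≤ q) (ν : ℕ) :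
    (1 - th E * xq E q ν ^ q) * (lam q ν)⁻¹ = - xq E q ν ^ q := by
  have h : xq E q ν ^ q * th E ^ q ^ (ν + 1) = 1 := by
    have := xq_th (E := E) q ν
    rw [pow_succ, pow_mul, ← mul_pow, this, one_pow]
  have h2 := lam_ne (E := E) q hq ν
  rw [mul_inv_eq_iff_eq_mul₀ h2, lam, neg_mul, mul_sub, h]
  ring

theorem mu_mul (hq : 2 ≤ q) (ν : ℕ) (B : List (ℕ × k)) :
    (1 - th E * xq E q ν ^ q) ^ wtL B * mu q ι ν B =
      HahnSeries.C (ι (chL B)) * xq E q ν ^ (q * wtL B) := by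
  induction B with
  | nil => simp [mu, wtL, chL]
  | cons a B ih =>
    have hm : mu q ι ν (a :: B) = HahnSeries.C (ι a.2) * (lam q ν)⁻¹ ^ a.1 * mu q ι ν B := by
      simp [mu]
    rw [hm, wtL_cons, chL_cons, pow_add]
    have h1 : (1 - th E * xq E q ν ^ q) ^ a.1 * (lam q ν)⁻¹ ^ a.1 = (-1) ^ a.1 * xq E q ν ^ (q * a.1) := by
      rw [← mul_pow, lam_inv q hq, neg_pow, pow_mul]
    calc _ = ((1 - th E * xq E q ν ^ q) ^ a.1 * (lam q ν)⁻¹ ^ a.1) * HahnSeries.C (ι a.2) *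
          ((1 - th E * xq E q ν ^ q) ^ wtL B * mu q ι ν B) := by ring
      _ = _ := by
        rw [h1, ih]
        simp only [map_mul, map_pow, map_neg, map_one]
        ring

theorem mu_Tp (hq : 2 ≤ q) (W ν : ℕ) (B : List (ℕ × k)) (hW : wtL B ≤ W) :
    ev ι q ν ((1 - C X * X ^ q) ^ W) * mu q ι ν B = ev ι q ν (Tp q W B) := by
  have h := mu_mul q ι hq ν B
  rw [Tp]
  simp only [map_mul, map_pow, map_sub, map_one, ev_C, ev_X, phi_X, phi_C]
  rw [← h, show W = wtL B + (W - wtL B) by omega, pow_add, Nat.add_sub_cancel_left]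
  ring

theorem Vals_VV (hq : 2 ≤ q) {W : ℕ} {I : Finset (List (ℕ × k))} (hI : Idx q W I) :
    Vals ι q W I (VV q ι) where
  nil := VV_nil q ι
  og ν B hB := Og.hasSum (tm_summable q ι hq ν B (hI.pos B hB)).hasSum fun g =>
    (tm_Og q ι hq ν B (hI.pos B hB) g).mono (by positivity)
  recur ν B hB := by
    have hW := hI.wt B hB
    cases B with
    | nil =>
      rw [VV_nil, VV_nil, ← mu_Tp q ι hq W ν [] hW]
      simp [mu]
    | cons a B =>
      have hW' := hI.wt B (hI.tail _ hB)
      rw [if_pos (by simp), List.tail_cons, ← mu_Tp q ι hq W ν _ hW, ← mu_Tp q ι hq W ν _ hW',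
        VV_cons q ι hq ν a B (hI.pos _ hB)]
      ring
end VV

section Final
theorem VV_len {E : Type} [Field E] (q : ℕ) (ι : k →+* E) (ν : ℕ) (B : List (ℕ × k)) (n : ℕ) (hn : B.length = n) :
    VV q ι ν B = ∑' g : SS n, ∏ i : Fin n, Gt q ι ν (B.get (Fin.cast hn.symm i)) (g.1 i) := by
  subst hn
  rfl

theorem VV_ofFn {E : Type} [Field E] (q : ℕ) (ι : k →+* E) (ν : ℕ) {n : ℕ} (f : Fin n → ℕ × k) :
    VV q ι ν (List.ofFn f) = ∑' g : SS n, ∏ i : Fin n, Gt q ι ν (f i) (g.1 i) := by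
  rw [VV_len q ι ν _ n (by simp)]
  simp

def revE (n : ℕ) : {f : Fin n → ℕ // StrictAnti f} ≃ SS n where
  toFun f := ⟨fun i => f.1 i.rev, fun i j h => f.2 (Fin.rev_lt_rev.2 h)⟩
  invFun f := ⟨fun i => f.1 i.rev, fun i j h => f.2 (Fin.rev_lt_rev.2 h)⟩
  left_inv f := by ext i; simp
  right_inv f := by ext i; simp

variable {Fq : Type} [Field Fq] [Fintype Fq]

theorem ell_eq (d : ℕ) : ell Fq d = ∏ i ∈ range d, lam (E := Fb Fq) (qc Fq) (0 + i) := by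
  induction d with
  | zero => simp [ell]
  | succ d ih =>
    rw [prod_range_succ, ← ih, ell, ell, Finset.prod_Icc_succ_top (by omega), zero_add]
    rfl

theorem Li_eq (κ : k →+* Fb Fq) (A : PArr (Fb Fq)) (e : Fin A.depth → k) (he : ∀ i, κ (e i) = A.eps i) :
    Li Fq A = VV (qc Fq) κ 0 (List.ofFn fun i => (A.s i.rev, e i.rev)) := by
  rw [VV_ofFn, Li, ← (revE A.depth).tsum_eq]
  refine tsum_congr fun d => ?_
  rw [← Equiv.prod_comp Fin.revPerm]
  refine prod_congr rfl fun i _ => ?_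
  simp only [Gt, revE, Equiv.coe_fn_mk, ← ell_eq, he]
  rfl

variable (Fq) in
theorem kN_finite (N : ℕ) (hN : 0 < N) : Finite (kN Fq N) := by
  have hfin : Set.Finite {x : Fb Fq | x ^ N = 1} := by
    refine ((X ^ N - 1 : (Fb Fq)[X]).roots.toFinset.finite_toSet).subset ?_
    intro x hx
    have h0 : (X ^ N - 1 : (Fb Fq)[X]) ≠ 0 := X_pow_sub_C_ne_zero hN 1
    have hx' : x ^ N = 1 := hx
    simp [h0, hx']
  haveI : Finite {x : Fb Fq | x ^ N = 1} := hfin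
  have hfd : FiniteDimensional Fq (IntermediateField.adjoin Fq {x : Fb Fq | x ^ N = 1}) :=
    IntermediateField.finiteDimensional_adjoin fun x _ => Algebra.IsIntegral.isIntegral x
  have hf : Finite (IntermediateField.adjoin Fq {x : Fb Fq | x ^ N = 1}) := Module.finite_of_finite Fq
  have hle : kN Fq N ≤ (IntermediateField.adjoin Fq {x : Fb Fq | x ^ N = 1}).toSubfield := by
    rw [kN, Subfield.closure_le]
    rintro x (⟨y, rfl⟩ | hx)
    · exact IntermediateField.algebraMap_mem _ y
    · exact IntermediateField.subset_adjoin _ _ hx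
  have hs : Set.Finite ((IntermediateField.adjoin Fq {x : Fb Fq | x ^ N = 1} : IntermediateField Fq (Fb Fq)) : Set (Fb Fq)) := hf
  exact (hs.subset hle)

theorem frac (N : ℕ) (x : Kinf Fq) (hx : x ∈ KNf Fq N) :
    ∃ a b : (kN Fq N)[X], b ≠ 0 ∧ phi (kN Fq N).subtype b * x = phi (kN Fq N).subtype a := by
  rw [KNf] at hx
  induction hx using Subfield.closure_induction with
  | mem x hx =>
    rcases hx with ⟨c, hc, rfl⟩ | hx
    · refine ⟨C ⟨c, hc⟩, 1, one_ne_zero, ?_⟩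
      rw [phi_C, map_one, one_mul]; rfl
    · refine ⟨X, 1, one_ne_zero, ?_⟩
      rw [phi_X, map_one, one_mul]; exact hx
  | one => exact ⟨1, 1, one_ne_zero, by simp⟩
  | add x y _ _ hx hy =>
    obtain ⟨a, b, hb, h⟩ := hx
    obtain ⟨a', b', hb', h'⟩ := hy
    refine ⟨a * b' + a' * b, b * b', mul_ne_zero hb hb', ?_⟩
    rw [map_add, map_mul, map_mul, map_mul, ← h, ← h']; ring
  | neg x _ hx =>
    obtain ⟨a, b, hb, h⟩ := hx
    exact ⟨-a, b, hb, by rw [map_neg, ← h]; ring⟩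
  | mul x y _ _ hx hy =>
    obtain ⟨a, b, hb, h⟩ := hx
    obtain ⟨a', b', hb', h'⟩ := hy
    refine ⟨a * a', b * b', mul_ne_zero hb hb', ?_⟩
    rw [map_mul, map_mul, ← h, ← h']; ring
  | inv x _ hx =>
    obtain ⟨a, b, hb, h⟩ := hx
    by_cases h0 : x = 0
    · subst h0
      exact ⟨0, 1, one_ne_zero, by simp⟩
    · refine ⟨b, a, ?_, ?_⟩
      · rintro rfl
        rw [map_zero] at h
        rcases mul_eq_zero.1 h with h | h
        · exact hb (phi_inj _ _ h)
        · exact h0 h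
      · rw [← h, mul_assoc, mul_inv_cancel₀ h0, mul_one]

def wd {N w : ℕ} (A : SwIdx Fq N w) : List (ℕ × kN Fq N) :=
  List.ofFn fun i => (A.1.s i.rev, ⟨A.1.eps i.rev, Subfield.subset_closure (Or.inr (A.2.1.2 i.rev))⟩)

theorem Li_wd {N w : ℕ} (A : SwIdx Fq N w) : Li Fq A.1 = VV (qc Fq) (kN Fq N).subtype 0 (wd A) :=
  Li_eq (kN Fq N).subtype A.1 (fun i => ⟨A.1.eps i, Subfield.subset_closure (Or.inr (A.2.1.2 i))⟩)
    fun _ => rfl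

theorem wd_inj {N w : ℕ} (A B : SwIdx Fq N w) (h : wd A = wd B) : A = B := by
  obtain ⟨⟨n, s, e⟩, hA⟩ := A
  obtain ⟨⟨m, s', e'⟩, hB⟩ := B
  have hl : n = m := by simpa [wd] using congrArg List.length h
  subst hl
  have h2 := List.ofFn_injective h
  apply Subtype.ext
  show PArr.mk n s e = PArr.mk n s' e'
  congr 1
  · funext i
    have := congrArg Prod.fst (congrFun h2 i.rev)
    simpa using this
  · funext i
    have := congrArg (fun x => (x.2 : Fb Fq)) (congrFun h2 i.rev)
    simpa using this

theorem wd_wt {N w : ℕ} (A : SwIdx Fq N w) : wtL (wd A) = w := by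
  refine Eq.trans ?_ A.2.2.2.1
  rw [wtL, wd, List.map_ofFn, List.sum_ofFn, PArr.wt]
  exact Equiv.sum_comp Fin.revPerm A.1.s

theorem wd_mem {N w : ℕ} (hN : 0 < N) (A : SwIdx Fq N w) (x : ℕ × kN Fq N) (hx : x ∈ wd A) :
    0 < x.1 ∧ ¬ qc Fq ∣ x.1 ∧ x.2 ≠ 0 := by
  rw [wd, List.mem_ofFn] at hx
  obtain ⟨i, rfl⟩ := hx
  refine ⟨A.2.1.1 _, A.2.2.2.2 _, ?_⟩
  intro h
  have h1 := congrArg (Subtype.val (p := fun x => x ∈ kN Fq N)) h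
  have h2 := A.2.1.2 i.rev
  simp only [ZeroMemClass.coe_zero] at h1
  rw [h1, zero_pow (by omega)] at h2
  exact zero_ne_one h2

theorem suf_idx {N w : ℕ} (hN : 0 < N) (s : Finset (SwIdx Fq N w)) :
    Idx (qc Fq) w (s.biUnion fun A => (wd A).tails.toFinset) where
  tail B hB := by
    simp only [mem_biUnion, List.mem_toFinset, List.mem_tails] at hB ⊢
    obtain ⟨A, hA, h⟩ := hB
    exact ⟨A, hA, (List.tail_suffix B).trans h⟩
  pos B hB x hx := by
    simp only [mem_biUnion, List.mem_toFinset, List.mem_tails] at hB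
    obtain ⟨A, hA, h⟩ := hB
    exact (wd_mem hN A x (h.subset hx)).1
  ndvd B hB x hx := by
    simp only [mem_biUnion, List.mem_toFinset, List.mem_tails] at hB
    obtain ⟨A, hA, h⟩ := hB
    exact (wd_mem hN A x (h.subset hx)).2.1
  ne B hB x hx := by
    simp only [mem_biUnion, List.mem_toFinset, List.mem_tails] at hB
    obtain ⟨A, hA, h⟩ := hB
    exact (wd_mem hN A x (h.subset hx)).2.2
  wt B hB := by
    simp only [mem_biUnion, List.mem_toFinset, List.mem_tails] at hB
    obtain ⟨A, hA, t, h⟩ := hB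
    have := wd_wt A
    rw [← h, wtL, List.map_append, List.sum_append] at this
    rw [wtL]; omega

variable (Fq) in
theorem main (N w : ℕ) (hN : 0 < N) :
    LinearIndependent (KNf Fq N) (fun A : SwIdx Fq N w => Li Fq A.1) := by
  rw [linearIndependent_iff']
  intro s g hg
  haveI := kN_finite Fq N hN
  have hq : 2 ≤ qc Fq := Fintype.one_lt_card
  choose a b hb hab using fun i => frac N (g i : Kinf Fq) (g i).2
  set φ := phi (kN Fq N).subtype with hφ
  let c : SwIdx Fq N w → (kN Fq N)[X] := fun i => a i * ∏ j ∈ s.erase i, b j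
  let D : (kN Fq N)[X] := ∏ j ∈ s, b j
  have hD : D ≠ 0 := prod_ne_zero_iff.2 fun i _ => hb i
  have hc : ∀ i ∈ s, φ (c i) = φ D * (g i : Kinf Fq) := by
    intro i hi
    show φ (a i * ∏ j ∈ s.erase i, b j) = φ (∏ j ∈ s, b j) * _
    rw [← mul_prod_erase s b hi, map_mul, map_mul, ← hab]; ring
  have hI := suf_idx hN s
  have hV := Vals_VV (qc Fq) (kN Fq N).subtype hq hI
  have hmem : ∀ i ∈ s, wd i ∈ s.biUnion fun A => (wd A).tails.toFinset := by
    intro i hi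
    simp only [mem_biUnion, List.mem_toFinset, List.mem_tails]
    exact ⟨i, hi, List.suffix_refl _⟩
  have key := part1 hq hI hV (fun B => ∑ i ∈ s, if wd i = B then c i else 0) (by
    simp only [← hφ, map_sum, sum_mul]
    rw [sum_comm]
    have : ∀ i ∈ s, (∑ B ∈ s.biUnion (fun A => (wd A).tails.toFinset),
        φ (if wd i = B then c i else 0) * VV (qc Fq) (kN Fq N).subtype 0 B) =
        φ D * (g i • Li Fq i.1) := by
      intro i hi
      rw [sum_eq_single (wd i)]
      · rw [if_pos rfl, hc i hi, ← Li_wd, Subfield.smul_def, smul_eq_mul, mul_assoc]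
      · intro B _ hB
        rw [if_neg (Ne.symm hB), map_zero, zero_mul]
      · intro h; exact absurd (hmem i hi) h
    rw [sum_congr rfl this, ← mul_sum, hg, mul_zero])
  intro i hi
  have h := key (wd i) (hmem i hi)
  rw [sum_eq_single i, if_pos rfl] at h
  · have h2 := hc i hi
    rw [h, map_zero] at h2
    rcases mul_eq_zero.1 h2.symm with h3 | h3
    · exact absurd (phi_inj _ _ h3) hD
    · exact Subtype.ext h3
  · intro j _ hj
    rw [if_neg fun hh => hj (wd_inj _ _ hh)]
  · intro hh; exact absurd hi hh

end Final

end Core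

set_option synthInstance.maxHeartbeats 1000000

/-- **Linear independence of the proposed basis** (Theorem `transcendence`): the family
`{Li(𝛆;𝔰) : 𝔰 ∈ S_w, 𝛆 ∈ Γ_N^{depth 𝔰}}`, indexed by the pairs `(𝔰,𝛆)`, is linearly
independent over `K_N` inside `K_{N,∞}`. -/
theorem CMPL_basis_linearly_independent
    (Fq : Type) [Field Fq] [Fintype Fq] (N w : ℕ) (hN : 0 < N) (hw : 0 < w) :
    LinearIndependent (KNf Fq N) (fun A : SwIdx Fq N w => Li Fq A.1) := by
  exact Core.main Fq N w hN

end ZHPC
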